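/- arXiv:math/9807176 — 2 statements merged into one kernel-verified Lean document; each statement's English description precedes it below -/
import Mathlib

section
/- Let f₁,…,f_r ∈ R = ℂ[x₁,…,xₙ] generate a proper ideal I, and let c ≥ 1 be an integer such that the local cohomology modules H^j_I(R) vanish for all j > c (i.e., the cohomological dimension cd(f₁,…,f_r) is at most c). Then H^i(Tot(Ω^•(D_n) ⊗_{D_n} MV^•(f₁,…,f_r))) = 0 for all i ≥ n + c. -/
set_option synthInstance.maxHeartbeats 1000000
set_option maxHeartbeats 4000000
set_option linter.unusedVariables false

open scoped TensorProduct

noncomputable section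

/-- The polynomial ring `R = ℂ[x₁,…,xₙ]`. -/
abbrev Rp (n : ℕ) := MvPolynomial (Fin n) ℂ

/-- Multiplication by `xᵢ`, as a `ℂ`-linear endomorphism of `ℂ[x₁,…,xₙ]`. -/
def mulOp {n : ℕ} (i : Fin n) : Module.End ℂ (Rp n) :=
  LinearMap.mulLeft ℂ (MvPolynomial.X i)

/-- The partial derivative `∂ᵢ`, as a `ℂ`-linear endomorphism of `ℂ[x₁,…,xₙ]`. -/
def derOp {n : ℕ} (i : Fin n) : Module.End ℂ (Rp n) :=
  (MvPolynomial.pderiv i).toLinearMap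

/-- The `n`-th Weyl algebra `Dₙ`, realized concretely as the `ℂ`-subalgebra of the
`ℂ`-linear endomorphisms of `ℂ[x₁,…,xₙ]` generated by the multiplication
operators `x₁,…,xₙ` and the partial derivative operators `∂₁,…,∂ₙ`. -/
def Weyl (n : ℕ) : Subalgebra ℂ (Module.End ℂ (Rp n)) :=
  Algebra.adjoin ℂ (Set.range (mulOp (n := n)) ∪ Set.range (derOp (n := n)))

/-- The element `xᵢ` of the Weyl algebra. -/
def wx {n : ℕ} (i : Fin n) : Weyl n :=
  ⟨mulOp i, Algebra.subset_adjoin (Or.inl ⟨i, rfl⟩)⟩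

/-- The element `∂ᵢ` of the Weyl algebra. -/
def wd {n : ℕ} (i : Fin n) : Weyl n :=
  ⟨derOp i, Algebra.subset_adjoin (Or.inr ⟨i, rfl⟩)⟩

instance (priority := 10000) weylRing (n : ℕ) : Ring ↥(Weyl n) :=
  inferInstanceAs (Ring ↥(Weyl n).toSubring)

instance (priority := 10000) weylAddCommGroup (n : ℕ) : AddCommGroup ↥(Weyl n) :=
  (weylRing n).toAddCommGroup

instance (priority := 10000) weylModC (n : ℕ) : Module ℂ ↥(Weyl n) :=
  inferInstance

instance (priority := 10000) weylAlgebra (n : ℕ) : Algebra ℂ ↥(Weyl n) :=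
  inferInstance

/-- Subsets of `{1,…,n}` of cardinality `k` (for `k : ℤ`); these index a basis
of `Λ^k(ℤⁿ)`. -/
def Fsub (n : ℕ) (k : ℤ) := { s : Finset (Fin n) // (s.card : ℤ) = k }

/-- The sign `(-1)^t` for `t : ℤ`. -/
def zsign (t : ℤ) : ℤ := if Even t then 1 else -1

/-- The canonical map of localizations `R_p → R_q` when `p ∣ q`. -/
def locMap {n : ℕ} {p q : Rp n} (h : p ∣ q) :
    Localization.Away p →+* Localization.Away q :=
  IsLocalization.Away.lift (S := Localization.Away p)
    (g := algebraMap (Rp n) (Localization.Away q)) p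
    (IsLocalization.Away.isUnit_of_dvd (x := q) h)

/-- The index set of the degree-`q` term of the Mayer–Vietoris complex
`MV^•(f₁,…,f_r)`: nonempty subsets `I ⊆ {1,…,r}` with `|I| = q + 1`. -/
def MVIdx (r : ℕ) (q : ℤ) : Type :=
  { S : Finset (Fin r) // S.Nonempty ∧ (S.card : ℤ) = q + 1 }

/-- The total complex of `Ω^•(Dₙ) ⊗_{Dₙ} MV^•(f₁,…,f_r)`, where
`MV^q(F) = ⊕_{|I|=q+1} R_{f_I}` and `Ω^p(Dₙ) ⊗_{Dₙ} R_{f_I} ≅ R_{f_I} ⊗ Λ^p(ℤⁿ)`: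
in total degree `j`, it assigns to each column `q`, each subset
`T ⊆ {1,…,n}` with `|T| = j - q`, and each `I ∈ MVIdx`, an element of the
localization `R_{f_I}`. -/
abbrev TotMV (n r : ℕ) (f : Fin r → Rp n) (j : ℤ) : Type :=
  (q : ℤ) → Fsub n (j - q) → (S : MVIdx r q) → Localization.Away (∏ i ∈ S.1, f i)

/-- The differential of the total complex of `Ω^•(Dₙ) ⊗_{Dₙ} MV^•(F)` (zero
unless `j = i + 1`): the de Rham differential `Σ_l ± ∂_l` (through the given
partial derivative operators `DD` on the localizations) plus `(-1)^p` times
the Mayer–Vietoris differential, whose components are the canonical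
localization maps `R_{f_I} → R_{f_{I∪{a}}}` with signs `(-1)^{sgn(I,a)}`. -/
def totMVD (n r : ℕ) (f : Fin r → Rp n)
    (DD : ∀ (S : Finset (Fin r)) (l : Fin n),
      Localization.Away (∏ i ∈ S, f i) → Localization.Away (∏ i ∈ S, f i))
    (i j : ℤ) : TotMV n r f i → TotMV n r f j := fun u =>
  if h : j = i + 1 then
    fun q T S =>
      (∑ l ∈ T.1.attach,
        zsign ((T.1.filter (fun x => x < l.1)).card) •
          DD S.1 l.1 (u q ⟨T.1.erase l.1, by
            rw [Finset.card_erase_of_mem l.2]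
            have h2 := T.2
            have h3 : 0 < T.1.card := Finset.card_pos.mpr ⟨l.1, l.2⟩
            omega⟩ S)) +
      zsign (j - q) •
        (if hq : 1 ≤ q then
          ∑ a ∈ S.1.attach,
            zsign ((S.1.filter (fun x => a.1 < x)).card) •
              locMap (Finset.prod_dvd_prod_of_subset _ _ _ (Finset.erase_subset a.1 S.1))
                (u (q - 1) ⟨T.1, by have h2 := T.2; omega⟩
                  ⟨S.1.erase a.1, by
                    have he := Finset.card_erase_of_mem a.2
                    have h2 := S.2.2
                    constructor
                    · apply Finset.card_pos.mp
                      omega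
                    · omega⟩)
        else 0)
  else 0


section

open CategoryTheory Limits Opposite

theorem HomologicalComplex.exists_factor_of_homologyMap_comp_eq_zero
    {D : Type*} [Category* D] [Abelian D] {K L : ChainComplex D ℕ} (φ : K ⟶ L) (m : ℕ)
    {W : D} [Injective W] (z : L.X (m + 1) ⟶ W) (hz : L.d (m + 2) (m + 1) ≫ z = 0)
    (h : HomologicalComplex.homologyMap φ (m + 1) ≫ L.homologyι (m + 1) ≫
      L.descOpcycles z (m + 2) (by simp) hz = 0) :
    ∃ ψ : K.X m ⟶ W, φ.f (m + 1) ≫ z = K.d (m + 1) m ≫ ψ := by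
  have hS : (ShortComplex.mk (K.homologyι (m + 1)) (K.fromOpcycles (m + 1) m)
      (by simp)).Exact := by
    apply ShortComplex.exact_of_f_is_kernel
    exact K.homologyIsKernel (m+1) m (by simp)
  have hz' : K.d (m + 2) (m + 1) ≫ φ.f (m + 1) ≫ z = 0 := by
    rw [← φ.comm_assoc, hz, comp_zero]
  have h0 : K.homologyι (m + 1) ≫ K.descOpcycles (φ.f (m + 1) ≫ z) (m + 2) (by simp) hz' = 0 := by
    rw [← h, ← Category.assoc, HomologicalComplex.homologyι_naturality, Category.assoc]
    congr 1
    rw [← cancel_epi (K.pOpcycles (m + 1))]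
    simp
  refine ⟨hS.descToInjective _ h0, ?_⟩
  have := hS.comp_descToInjective _ h0
  rw [← K.p_fromOpcycles, Category.assoc]
  erw [this]
  simp

theorem CategoryTheory.ProjectiveResolution.exists_factor_of_leftDerived_map_comp_eq_zero
    {C D : Type*} [Category* C] [Category* D] [Abelian C] [Abelian D] [EnoughProjectives C]
    (F : C ⥤ D) [F.Additive] {Y : C} (Q : ProjectiveResolution Y) (m : ℕ) {W : D} [Injective W]
    (z : F.obj (Q.complex.X (m + 1)) ⟶ W) (hz : F.map (Q.complex.d (m + 2) (m + 1)) ≫ z = 0) :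
    ∃ h : (F.leftDerived (m + 1)).obj Y ⟶ W,
      ∀ (X : C) (P : ProjectiveResolution X) (f : X ⟶ Y),
        (F.leftDerived (m + 1)).map f ≫ h = 0 →
        ∃ ψ : F.obj (P.complex.X m) ⟶ W, F.map ((ProjectiveResolution.lift f P Q).f (m + 1)) ≫ z =
          F.map (P.complex.d (m + 1) m) ≫ ψ := by
  refine ⟨(Q.isoLeftDerivedObj F (m + 1)).hom ≫ HomologicalComplex.homologyι _ (m + 1) ≫
    HomologicalComplex.descOpcycles (K := (F.mapHomologicalComplex _).obj Q.complex)
      z (m + 2) (by simp) hz, fun X P f h => ?_⟩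
  refine HomologicalComplex.exists_factor_of_homologyMap_comp_eq_zero
    ((F.mapHomologicalComplex _).map (ProjectiveResolution.lift f P Q)) m z hz ?_
  rw [ProjectiveResolution.isoLeftDerivedObj_hom_naturality_assoc f P Q
    (ProjectiveResolution.lift f P Q) (ProjectiveResolution.lift_commutes_zero f P Q) F
    (m + 1)] at h
  exact (cancel_epi (P.isoLeftDerivedObj F (m + 1)).hom).1 (h.trans comp_zero.symm)

variable {R : Type} [CommRing R]

theorem CategoryTheory.ProjectiveResolution.exists_factor_of_ext
    {Y : ModuleCat.{0} R} (M : ModuleCat.{0} R)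
    (Q : ProjectiveResolution Y) (m : ℕ)
    (z : Q.complex.X (m + 1) ⟶ M) (hz : Q.complex.d (m + 2) (m + 1) ≫ z = 0) :
    ∃ e : ((Ext R (ModuleCat.{0} R) (m + 1)).obj (op Y)).obj M,
      ∀ (X : ModuleCat.{0} R) (P : ProjectiveResolution X) (f : X ⟶ Y),
        (((Ext R (ModuleCat.{0} R) (m + 1)).map f.op).app M).hom e = 0 →
        ∃ ψ : P.complex.X m ⟶ M, (ProjectiveResolution.lift f P Q).f (m + 1) ≫ z =
          P.complex.d (m + 1) m ≫ ψ := by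
  let F : ModuleCat.{0} R ⥤ (ModuleCat.{0} R)ᵒᵖ :=
    ((linearYoneda R (ModuleCat.{0} R)).obj M).rightOp
  let W : (ModuleCat.{0} R)ᵒᵖ := op (ModuleCat.of R R)
  have key : ∀ {A B : ModuleCat.{0} R} (a : A ⟶ B) (z : B ⟶ M),
      F.map a ≫ (ModuleCat.ofHom (LinearMap.toSpanSingleton R (B ⟶ M) z)).op =
      (ModuleCat.ofHom (LinearMap.toSpanSingleton R (A ⟶ M) (a ≫ z))).op := by
    intro A B a z
    apply Quiver.Hom.unop_inj
    ext
    change a ≫ ((1 : R) • z) = (1 : R) • (a ≫ z)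
    simp
  have : Projective (ModuleCat.of R R) := by
    rw [← IsProjective.iff_projective]; infer_instance
  have : Injective W := inferInstanceAs (Injective (op (ModuleCat.of R R)))
  obtain ⟨h, hh⟩ := exists_factor_of_leftDerived_map_comp_eq_zero F Q m (W := W)
    (ModuleCat.ofHom (LinearMap.toSpanSingleton R (Q.complex.X (m + 1) ⟶ M) z)).op (by
      rw [key, hz]; simp; rfl)
  refine ⟨h.unop.hom (1 : R), fun X P f he => ?_⟩
  obtain ⟨ψ, hψ⟩ := hh X P f (by
    apply Quiver.Hom.unop_inj
    ext
    exact he)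
  refine ⟨ψ.unop.hom (1 : R), ?_⟩
  rw [key] at hψ
  have := congrArg (fun t => t.unop.hom (1 : R)) hψ
  exact (one_smul R _).symm.trans this

open localCohomology in
theorem localCohomology.exists_map_eq_zero (J : Ideal R) (j : ℕ) (M : ModuleCat.{0} R)
    (h : Subsingleton ((localCohomology J j).obj M)) (t : ℕ)
    (e : ((Ext R (ModuleCat.{0} R) j).obj (op (ModuleCat.of R (R ⧸ J ^ t)))).obj M) :
    ∃ (s : ℕ) (hs : t ≤ s), (((Ext R (ModuleCat.{0} R) j).map (ModuleCat.ofHom (Submodule.mapQ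
      (J ^ s) (J ^ t) LinearMap.id (Ideal.pow_le_pow_right hs))).op).app M).hom e = 0 := by
  let G := diagram (idealPowersDiagram J) j
  have hc := isColimitOfPreserves ((evaluation _ _).obj M) (colimit.isColimit G)
  obtain ⟨k, g, hg⟩ := Concrete.isColimit_exists_of_rep_eq.{0}
    (G ⋙ (evaluation _ _).obj M) (i := op (op t)) (j := op (op t)) hc e 0 (h.elim _ _)
  obtain ⟨g', hg⟩ := hg
  refine ⟨k.unop.unop, g.unop.unop.down.down, ?_⟩
  rw [map_zero] at hg
  exact hg

end

section

open CategoryTheory Limits Opposite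

/-- For an inverse system `Y` (with transition maps `f`), the condition that every class in
`Ext^{j+1}(Y t, M)` becomes zero in `Ext^{j+1}(Y s, M)` for some `s ≥ t`, in terms of cocycles. -/
def EventuallyExtZero {C : Type*} [Category* C] [Abelian C] [EnoughProjectives C] (Y : ℕ → C)
    (f : ∀ s t, t ≤ s → (Y s ⟶ Y t)) (j : ℕ) (M : C) : Prop :=
  ∀ (t : ℕ) (z : (projectiveResolution (Y t)).complex.X (j + 1) ⟶ M),
    (projectiveResolution (Y t)).complex.d (j + 2) (j + 1) ≫ z = 0 →
    ∃ (s : ℕ) (hs : t ≤ s) (ψ : (projectiveResolution (Y s)).complex.X j ⟶ M),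
      (ProjectiveResolution.lift (f s t hs) (projectiveResolution (Y s))
        (projectiveResolution (Y t))).f (j + 1) ≫ z =
      (projectiveResolution (Y s)).complex.d (j + 1) j ≫ ψ

namespace EventuallyExtZero

variable {C : Type*} [Category* C] [Abelian C] [EnoughProjectives C] {Y : ℕ → C}
    {f : ∀ s t, t ≤ s → (Y s ⟶ Y t)} {S : ShortComplex C}

theorem exists_sub (hS : S.ShortExact)
    {j : ℕ} (h : EventuallyExtZero Y f j S.X₁) (t : ℕ)
    (z : (projectiveResolution (Y t)).complex.X j ⟶ S.X₃)
    (hz : (projectiveResolution (Y t)).complex.d (j + 1) j ≫ z = 0) :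
    ∃ (s : ℕ) (hs : t ≤ s) (χ : (projectiveResolution (Y s)).complex.X j ⟶ S.X₂),
      (projectiveResolution (Y s)).complex.d (j + 1) j ≫ χ = 0 ∧ χ ≫ S.g =
        (ProjectiveResolution.lift (f s t hs) (projectiveResolution (Y s))
          (projectiveResolution (Y t))).f j ≫ z := by
  have := hS.mono_f
  have := hS.epi_g
  let z₂ : _ ⟶ S.X₂ := Projective.factorThru z S.g
  have hz₂ : z₂ ≫ S.g = z := Projective.factorThru_comp z S.g
  obtain ⟨w, hw⟩ := hS.exact.lift' ((projectiveResolution (Y t)).complex.d (j + 1) j ≫ z₂)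
    (by rw [Category.assoc, hz₂, hz])
  obtain ⟨s, hs, ψ, hψ⟩ := h t w (by rw [← cancel_mono S.f]; simp [hw])
  refine ⟨s, hs, (ProjectiveResolution.lift (f s t hs) (projectiveResolution (Y s))
    (projectiveResolution (Y t))).f j ≫ z₂ - ψ ≫ S.f, ?_, by simp [hz₂]⟩
  rw [Preadditive.comp_sub, ← Category.assoc _ ψ, ← hψ, Category.assoc, hw,
    ← HomologicalComplex.Hom.comm_assoc, sub_self]

theorem shift (hS : S.ShortExact) [Injective S.X₂] {j : ℕ}
    (h : EventuallyExtZero Y f (j + 1) S.X₁) : EventuallyExtZero Y f j S.X₃ := by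
  intro t z hz
  obtain ⟨s, hs, χ, hχ, hχz⟩ := h.exists_sub hS t z hz
  let E := (projectiveResolution (Y s)).exact_succ j
  refine ⟨s, hs, E.descToInjective χ hχ ≫ S.g, ?_⟩
  rw [← hχz, ← Category.assoc]
  congr 1
  exact (E.comp_descToInjective χ hχ).symm

theorem exists_hom_comp_eq (hS : S.ShortExact) (h : EventuallyExtZero Y f 0 S.X₁) (t : ℕ)
    (g : Y t ⟶ S.X₃) : ∃ (s : ℕ) (hs : t ≤ s) (e : Y s ⟶ S.X₂), e ≫ S.g = f s t hs ≫ g := by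
  obtain ⟨s, hs, χ, hχ, hχz⟩ := h.exists_sub hS t
    (show _ ⟶ S.X₃ from (projectiveResolution (Y t)).π.f 0 ≫ g)
    ((projectiveResolution (Y t)).complex_d_comp_π_f_zero_assoc g |>.trans zero_comp)
  have : Epi ((projectiveResolution (Y s)).π.f 0) := inferInstance
  obtain ⟨e, he⟩ := (projectiveResolution (Y s)).exact₀.desc' χ hχ
  refine ⟨s, hs, e, ?_⟩
  refine (cancel_epi ((projectiveResolution (Y s)).π.f 0)).1 ?_
  refine (Category.assoc _ _ _).symm.trans ?_
  refine (congrArg (· ≫ S.g) he).trans (hχz.trans ?_)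
  exact (ProjectiveResolution.lift_commutes_zero_assoc (f s t hs) (projectiveResolution (Y s))
    (projectiveResolution (Y t)) g).trans (Category.assoc _ _ _)

end EventuallyExtZero

end

section Sign

variable {ι : Type*} [DecidableEq ι]

theorem zsign_add_one (t : ℤ) : zsign (t + 1) = -zsign t := by
  unfold zsign
  by_cases h : Even t <;> simp [h]

theorem zsign_mul_self (t : ℤ) : zsign t * zsign t = 1 := by
  unfold zsign
  split <;> simp

/-- In an alternating double sum over pairs of distinct elements, removed one after the other, the
terms cancel in pairs. -/
theorem sum_zsign_smul_sum_erase_eq_zero {A : Type*} [AddCommGroup A] (r : ι → ι → Prop)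
    [DecidableRel r] (hr : ∀ l m, l ≠ m → (r l m ↔ ¬ r m l)) (T : Finset ι) (g : ι → ι → A)
    (hg : ∀ l ∈ T, ∀ m ∈ T, l ≠ m → g l m = g m l) :
    ∑ l ∈ T, zsign ((T.filter (fun x => r x l)).card) •
      ∑ m ∈ T.erase l, zsign (((T.erase l).filter (fun x => r x m)).card) • g l m = 0 := by
  have hs : ∀ l ∈ T, ∀ m, r l m →
      zsign (T.filter (fun x => r x m)).card =
        -zsign ((T.erase l).filter (fun x => r x m)).card := by
    intro l hl m hlm
    have hl' : l ∈ T.filter (fun x => r x m) := Finset.mem_filter.2 ⟨hl, hlm⟩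
    rw [Finset.filter_erase, ← zsign_add_one, ← Finset.card_erase_add_one hl']
    push_cast
    rfl
  have hs' : ∀ l m, ¬ r l m →
      zsign ((T.erase l).filter (fun x => r x m)).card =
        zsign (T.filter (fun x => r x m)).card := by
    intro l m hlm
    rw [Finset.filter_erase, Finset.erase_eq_of_notMem (by simp [hlm])]
  simp_rw [Finset.smul_sum]
  rw [Finset.sum_sigma']
  refine Finset.sum_involution (fun p _ => ⟨p.2, p.1⟩) ?_ ?_ ?_ ?_
  · rintro ⟨l, m⟩ h
    simp only [Finset.mem_sigma, Finset.mem_erase] at h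
    obtain ⟨hl, hml, hm⟩ := h
    simp only [smul_smul]
    rw [hg m hm l hl hml, ← add_smul]
    convert zero_smul ℤ _
    by_cases hlm : r l m
    · rw [hs l hl m hlm, hs' m l ((hr l m hml.symm).1 hlm)]
      ring
    · rw [hs' l m hlm, hs m hm l ((hr m l hml).2 hlm)]
      ring
  · rintro ⟨l, m⟩ h _ h2
    simp only [Finset.mem_sigma, Finset.mem_erase] at h
    simp only [Sigma.mk.injEq] at h2
    exact h.2.1 h2.1
  · rintro ⟨l, m⟩ h
    simp only [Finset.mem_sigma, Finset.mem_erase] at h ⊢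
    exact ⟨h.2.2, h.2.1.symm, h.1⟩
  · rintro ⟨l, m⟩ h
    rfl

end Sign

section CechDifferential

theorem restrict_congr {ι R : Type*} [CommRing R] {C : Finset ι → Type*}
    [∀ S, AddCommGroup (C S)] [∀ S, Module R (C S)]
    (ρ : ∀ {S T : Finset ι}, S ⊆ T → C S →ₗ[R] C T) (u : ∀ S, C S) {S S' T : Finset ι}
    (e : S = S') (h : S ⊆ T) (h' : S' ⊆ T) : ρ h (u S) = ρ h' (u S') := by
  subst e
  rfl

variable {ι : Type*} [LinearOrder ι] {R : Type*} [CommRing R] {C : Finset ι → Type*}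
  [∀ S, AddCommGroup (C S)] [∀ S, Module R (C S)]

/-- The alternating differential on families indexed by finite sets, for a system of restriction
maps `ρ` along inclusions. -/
def cechD (ρ : ∀ {S T : Finset ι}, S ⊆ T → C S →ₗ[R] C T) :
    (∀ S, C S) →ₗ[R] ∀ S, C S :=
  LinearMap.pi fun S => ∑ a ∈ S, zsign ((S.filter (fun x => a < x)).card) •
    (ρ (Finset.erase_subset a S) ∘ₗ LinearMap.proj (S.erase a))

variable (ρ : ∀ {S T : Finset ι}, S ⊆ T → C S →ₗ[R] C T)

theorem cechD_apply (u : ∀ S, C S) (S : Finset ι) :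
    cechD ρ u S = ∑ a ∈ S, zsign ((S.filter (fun x => a < x)).card) •
      ρ (Finset.erase_subset a S) (u (S.erase a)) := by
  simp [cechD]

theorem cechD_congr {u v : ∀ S, C S} {k : ℕ} (h : ∀ S, S.card = k → u S = v S) (S : Finset ι)
    (hS : S.card = k + 1) : cechD ρ u S = cechD ρ v S := by
  rw [cechD_apply, cechD_apply]
  refine Finset.sum_congr rfl fun a ha => ?_
  rw [h _ (by rw [Finset.card_erase_of_mem ha, hS, Nat.add_sub_cancel])]

theorem cechD_cechD (hρ : ∀ {S T U : Finset ι} (h : S ⊆ T) (h' : T ⊆ U) (x : C S),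
      ρ h' (ρ h x) = ρ (h.trans h') x) (u : ∀ S, C S) (S : Finset ι) :
    cechD ρ (cechD ρ u) S = 0 := by
  simp_rw [cechD_apply, map_sum, map_zsmul, hρ]
  have h : ∀ l m, (S.erase l).erase m ⊆ S := fun l m =>
    (Finset.erase_subset _ _).trans (Finset.erase_subset _ _)
  exact sum_zsign_smul_sum_erase_eq_zero (fun x y => y < x)
    (fun l m hlm => by rw [not_lt]; exact ⟨le_of_lt, fun h => lt_of_le_of_ne h hlm.symm⟩) S
    (fun l m => ρ (h l m) (u ((S.erase l).erase m)))
    (fun l _ m _ _ => restrict_congr ρ u Finset.erase_right_comm _ _)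

theorem cechD_insert (u : ∀ S, C S) (S : Finset ι) (b : ι) (hb : ∀ a ∈ S, a < b) :
    cechD ρ u (insert b S) = ρ (Finset.subset_insert b S) (u S) -
      ∑ a ∈ S, zsign ((S.filter (fun x => a < x)).card) •
        ρ (Finset.insert_subset_insert b (Finset.erase_subset a S)) (u (insert b (S.erase a))) := by
  have hbS : b ∉ S := fun h => lt_irrefl _ (hb b h)
  rw [cechD_apply, Finset.sum_insert hbS, sub_eq_add_neg, ← Finset.sum_neg_distrib]
  congr 1
  · rw [Finset.filter_eq_empty_iff.2]
    · simp only [Finset.card_empty, zsign, Nat.cast_zero, Even.zero, if_true, one_smul]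
      exact restrict_congr ρ u (Finset.erase_insert hbS) _ _
    · intro x hx
      rcases Finset.mem_insert.1 hx with rfl | hx
      · simp
      · exact (hb x hx).le.not_gt
  · refine Finset.sum_congr rfl fun a ha => ?_
    rw [Finset.filter_insert, if_pos (hb a ha), Finset.card_insert_of_notMem (by simp [hbS]),
      Nat.cast_add, Nat.cast_one, zsign_add_one, neg_smul]
    congr 2
    exact restrict_congr ρ u (Finset.erase_insert_of_ne (hb a ha).ne') _ _

theorem cechD_singleton (u : ∀ S, C S) (a : ι) :
    cechD ρ u {a} = ρ (Finset.empty_subset {a}) (u ∅) := by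
  rw [cechD_apply, Finset.sum_singleton, Finset.filter_eq_empty_iff.2 (by simp)]
  simp only [Finset.card_empty, zsign, Nat.cast_zero, Even.zero, if_true, one_smul]
  exact restrict_congr ρ u (by simp) _ _

end CechDifferential

section LocalizationSystem

variable {R : Type} [CommRing R]

/-- The canonical map of localizations `R_p → R_q` for `p ∣ q`, as a map of `R`-algebras. -/
def awayAlgHom {p q : R} (h : p ∣ q) : Localization.Away p →ₐ[R] Localization.Away q :=
  IsLocalization.Away.liftAlgHom (S := Localization.Away p)
    (f := Algebra.ofId R (Localization.Away q)) (x := p)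
    (IsLocalization.Away.isUnit_of_dvd (x := q) h)

theorem awayAlgHom_awayAlgHom {p q s : R} (h : p ∣ q) (h' : q ∣ s) (x : Localization.Away p) :
    awayAlgHom h' (awayAlgHom h x) = awayAlgHom (h.trans h') x := by
  have : (awayAlgHom h').comp (awayAlgHom h) = awayAlgHom (h.trans h') :=
    IsLocalization.algHom_ext (Submonoid.powers p) (Subsingleton.elim _ _)
  exact DFunLike.congr_fun this x

theorem isLocalizedModule_awayAlgHom {p q b : R} (h : q = b * p) :
    IsLocalizedModule (Submonoid.powers b)
      (awayAlgHom (p := p) (q := q) (h ▸ Dvd.intro_left b rfl)).toLinearMap := by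
  have hpq : p ∣ q := h ▸ Dvd.intro_left b rfl
  refine ⟨?_, ?_, ?_⟩
  · rintro ⟨_, n, rfl⟩
    have hu : IsUnit (algebraMap R (Localization.Away q) (b ^ n)) := by
      rw [map_pow]
      exact (IsLocalization.Away.isUnit_of_dvd (x := q) (h ▸ Dvd.intro p rfl)).pow n
    rw [Module.End.isUnit_iff]
    convert IsUnit.isUnit_iff_mulLeft_bijective.1 hu using 1
    ext x
    exact Algebra.smul_def (b ^ n) x
  · intro y
    obtain ⟨n, a, ha⟩ := IsLocalization.Away.surj q y
    obtain ⟨v, hv⟩ := (IsLocalization.Away.algebraMap_pow_isUnit (S := Localization.Away p)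
      p n).exists_right_inv
    refine ⟨⟨algebraMap R _ a * v, ⟨b ^ n, n, rfl⟩⟩, ?_⟩
    have hv' := congrArg (awayAlgHom hpq) hv
    simp only [map_mul, map_pow, AlgHom.commutes, map_one] at hv'
    simp only [AlgHom.toLinearMap_apply, map_mul, AlgHom.commutes, ← ha, Submonoid.smul_def,
      Algebra.smul_def, map_pow]
    have hq : algebraMap R (Localization.Away q) q = algebraMap R _ b * algebraMap R _ p := by
      rw [← map_mul, ← h]
    rw [hq]
    linear_combination (-(algebraMap R (Localization.Away q) b ^ n * y)) * hv'
  · intro x y hxy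
    obtain ⟨n, a, ha⟩ := IsLocalization.Away.surj p (x - y)
    have h0 : algebraMap R (Localization.Away q) a = 0 := by
      rw [← (awayAlgHom hpq).commutes, ← ha, map_mul, map_sub]
      simp only [AlgHom.toLinearMap_apply] at hxy
      rw [hxy, sub_self, zero_mul]
    rw [← map_zero (algebraMap R (Localization.Away q))] at h0
    obtain ⟨k, hk⟩ := IsLocalization.Away.exists_of_eq q h0
    refine ⟨⟨b ^ k, k, rfl⟩, ?_⟩
    rw [← sub_eq_zero, ← smul_sub]
    have hu := (IsLocalization.Away.algebraMap_pow_isUnit (S := Localization.Away p) p (n + k))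
    rw [← hu.mul_right_eq_zero, Submonoid.smul_def, Algebra.smul_def]
    have := congrArg (algebraMap R (Localization.Away p)) hk
    simp only [h, map_mul, map_pow, mul_zero, ← ha, mul_pow, map_zero] at this
    simp only [map_pow, pow_add]
    linear_combination this

end LocalizationSystem

section CechSystem

variable {R : Type} [CommRing R] {ι : Type*} (f : ι → R)
  (M : Type) [AddCommGroup M] [Module R M]

/-- The term `R_{f_S} ⊗ M` of the Čech complex of `M`. -/
abbrev CechObj (S : Finset ι) : Type := Localization.Away (∏ i ∈ S, f i) ⊗[R] M

/-- The restriction maps of the Čech complex. -/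
def cechRes {S T : Finset ι} (h : S ⊆ T) : CechObj f M S →ₗ[R] CechObj f M T :=
  (awayAlgHom (Finset.prod_dvd_prod_of_subset S T f h)).toLinearMap.rTensor M

/-- The map from a module to the terms of its Čech complex. -/
def cechUnit (S : Finset ι) : M →ₗ[R] CechObj f M S :=
  TensorProduct.mk R _ M 1

variable {M}

theorem cechRes_cechRes {S T U : Finset ι} (h : S ⊆ T) (h' : T ⊆ U) (x : CechObj f M S) :
    cechRes f M h' (cechRes f M h x) = cechRes f M (h.trans h') x := by
  unfold cechRes
  rw [← LinearMap.comp_apply, ← LinearMap.rTensor_comp]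
  congr 2
  exact LinearMap.ext (awayAlgHom_awayAlgHom (Finset.prod_dvd_prod_of_subset S T f h)
    (Finset.prod_dvd_prod_of_subset T U f h'))

theorem cechRes_cechUnit {S T : Finset ι} (h : S ⊆ T) (m : M) :
    cechRes f M h (cechUnit f M S m) = cechUnit f M T m := by
  simp [cechRes, cechUnit]

theorem isLocalizedModule_cechRes [DecidableEq ι] {b : ι} {S : Finset ι} (hb : b ∉ S) :
    IsLocalizedModule (Submonoid.powers (f b)) (cechRes f M (Finset.subset_insert b S)) := by
  have := isLocalizedModule_awayAlgHom (Finset.prod_insert (f := f) hb)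
  exact IsLocalizedModule.rTensor (R := R) (A := R) (Submonoid.powers (f b)) (N := M) _

theorem smul_pow_bijective {b : ι} {S : Finset ι} (hb : b ∈ S) (k : ℕ) :
    Function.Bijective (fun x : CechObj f M S => f b ^ k • x) := by
  have hu : IsUnit (algebraMap R (Localization.Away (∏ i ∈ S, f i)) (f b ^ k)) := by
    rw [map_pow]
    exact (IsLocalization.Away.isUnit_of_dvd _ (Finset.dvd_prod_of_mem f hb)).pow k
  obtain ⟨v, hv⟩ := hu
  have : ∀ x : CechObj f M S, f b ^ k • x = (v : Localization.Away (∏ i ∈ S, f i)) • x := by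
    intro x
    rw [hv, algebraMap_smul]
  simp_rw [this]
  exact MulAction.bijective v

theorem cechUnit_empty_bijective : Function.Bijective (cechUnit f M ∅) := by
  have hu : IsUnit (∏ i ∈ (∅ : Finset ι), f i) := by simp
  have hb : Function.Bijective (algebraMap R (Localization.Away (∏ i ∈ (∅ : Finset ι), f i))) :=
    (IsLocalization.atUnit R _ _ hu).bijective
  let e : R ≃ₗ[R] Localization.Away (∏ i ∈ (∅ : Finset ι), f i) :=
    LinearEquiv.ofBijective (Algebra.linearMap R _) hb
  have : cechUnit f M ∅ = ((TensorProduct.lid R M).symm ≪≫ₗ e.rTensor M : M →ₗ[R] _) := by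
    refine LinearMap.ext fun m => ?_
    change 1 ⊗ₜ m = algebraMap R _ 1 ⊗ₜ m
    rw [map_one]
  rw [this]
  exact LinearEquiv.bijective _

theorem exists_pow_smul_eq_zero_of_cechUnit_eq_zero [DecidableEq ι] {a : ι} {m : M}
    (h : cechUnit f M {a} m = 0) : ∃ k : ℕ, f a ^ k • m = 0 := by
  have hl := isLocalizedModule_cechRes f (M := M) (Finset.notMem_empty a)
  rw [← cechRes_cechUnit f (Finset.empty_subset {a}),
    ← map_zero (cechRes f M (Finset.empty_subset {a}))] at h
  obtain ⟨⟨_, k, rfl⟩, hk⟩ := hl.exists_of_eq h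
  refine ⟨k, (cechUnit_empty_bijective f).1 ?_⟩
  simpa [Submonoid.smul_def] using hk

theorem cechUnit_eq_zero_of_pow_smul_eq_zero {a : ι} {S : Finset ι} (ha : a ∈ S) {m : M} {k : ℕ}
    (h : f a ^ k • m = 0) : cechUnit f M S m = 0 := by
  apply (smul_pow_bijective f ha k).1
  simp only [smul_zero]
  rw [← map_smul, h, map_zero]

end CechSystem

section Injective

variable {R : Type} [CommRing R] [IsNoetherianRing R] {E : Type} [AddCommGroup E] [Module R E]

/-- In an injective module over a Noetherian ring, an element killed by `J` becomes divisible by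
`g`, inside the `J`-torsion, after multiplication by a power of `g`. -/
theorem Module.Injective.exists_pow_smul_eq (hE : Module.Injective R E) (J : Ideal R) (g : R)
    (m : E) (hm : ∀ x ∈ J, x • m = 0) (N : ℕ) :
    ∃ (m' : E) (s : ℕ), (∀ x ∈ J, x • m' = 0) ∧ g ^ (s + N) • m' = g ^ s • m := by
  let K : ℕ →o Ideal R := ⟨fun s => Submodule.comap (LinearMap.mulLeft R (g ^ s)) J, by
    refine monotone_nat_of_le_succ fun s x hx => ?_
    simp only [Submodule.mem_comap, LinearMap.mulLeft_apply] at hx ⊢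
    rw [pow_succ', mul_assoc]
    exact J.mul_mem_left g hx⟩
  obtain ⟨s, hs⟩ := monotone_stabilizes_iff_noetherian.2 ‹IsNoetherianRing R› K
  have hK : ∀ t x, x ∈ K t ↔ g ^ t * x ∈ J := fun t x => Iff.rfl
  let φ : (R ⧸ K s) →ₗ[R] (R ⧸ J) :=
    Submodule.mapQ (K s) J (LinearMap.mulLeft R (g ^ (s + N))) fun x hx => by
      rw [hs (s + N) (Nat.le_add_right _ _)] at hx
      exact hx
  have hφ : Function.Injective φ := by
    rw [← LinearMap.ker_eq_bot, LinearMap.ker_eq_bot']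
    intro y hy
    obtain ⟨x, rfl⟩ := Submodule.Quotient.mk_surjective _ y
    rw [Submodule.mapQ_apply, Submodule.Quotient.mk_eq_zero] at hy
    rw [Submodule.Quotient.mk_eq_zero, hs (s + N) (Nat.le_add_right _ _)]
    exact hy
  let ψ : (R ⧸ K s) →ₗ[R] E := Submodule.liftQ (K s) (LinearMap.toSpanSingleton R E (g ^ s • m))
    fun x hx => by
      rw [LinearMap.mem_ker, LinearMap.toSpanSingleton_apply, smul_smul, mul_comm]
      exact hm _ hx
  obtain ⟨χ, hχ⟩ := hE.out φ hφ ψ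
  refine ⟨χ (Submodule.Quotient.mk 1), s, fun x hx => ?_, ?_⟩
  · rw [← map_smul, ← Submodule.Quotient.mk_smul, smul_eq_mul, mul_one,
      (Submodule.Quotient.mk_eq_zero J).2 hx, map_zero]
  · have := hχ (Submodule.Quotient.mk 1)
    rw [Submodule.mapQ_apply, Submodule.liftQ_apply, LinearMap.toSpanSingleton_apply, one_smul,
      LinearMap.mulLeft_apply] at this
    rw [← this, ← map_smul, ← Submodule.Quotient.mk_smul, smul_eq_mul]

variable {ι : Type*} [LinearOrder ι] [Finite ι] (f : ι → R)

theorem exists_uniform_exponent {α : Type*} [Finite α] {P : α → ℕ → Prop}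
    (hmono : ∀ a k l, k ≤ l → P a k → P a l) (h : ∀ a, ∃ k, P a k) : ∃ k, ∀ a, P a k := by
  choose k hk using h
  obtain ⟨N, hN⟩ := (Set.finite_range k).bddAbove
  exact ⟨N, fun a => hmono a _ _ (hN ⟨a, rfl⟩) (hk a)⟩

/-- The Čech complex of an injective module over a Noetherian ring is exact in positive degrees. -/
theorem cech_exact_of_injective (hE : Module.Injective R E) (A : Finset ι) :
    ∀ (j : ℕ) (u : ∀ S, CechObj f E S),
      (∀ S ⊆ A, S.card = j + 2 → cechD (cechRes f E) u S = 0) →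
      ∃ v : ∀ S, CechObj f E S, ∀ S ⊆ A, S.card = j + 1 → u S = cechD (cechRes f E) v S := by
  induction A using Finset.induction_on_max with
  | empty =>
    intro j u _
    refine ⟨0, fun S hS hj => ?_⟩
    rw [Finset.subset_empty.1 hS] at hj
    simp at hj
  | insert b A hbA ih =>
    have hb : b ∉ A := fun h => lt_irrefl _ (hbA b h)
    have hbS : ∀ S ⊆ A, b ∉ S := fun S hS h => hb (hS h)
    have hlt : ∀ S ⊆ A, ∀ a ∈ S, a < b := fun S hS a ha => hbA a (hS ha)
    have hsub : ∀ S ⊆ insert b A, b ∉ S → S ⊆ A := fun S hS h =>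
      (Finset.subset_insert_iff_of_notMem h).1 hS
    suffices H : ∀ (j : ℕ) (u : ∀ S, CechObj f E S),
        (∀ S ⊆ insert b A, S.card = j + 2 → cechD (cechRes f E) u S = 0) →
        (∀ S ⊆ A, S.card = j + 1 → u S = 0) →
        ∃ v : ∀ S, CechObj f E S,
          ∀ S ⊆ insert b A, S.card = j + 1 → u S = cechD (cechRes f E) v S by
      intro j u hu
      obtain ⟨v, hv⟩ := ih j u fun S hS hj => hu S (hS.trans (Finset.subset_insert b A)) hj
      obtain ⟨w, hw⟩ := H j (u - cechD (cechRes f E) v) (fun S hS hj => by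
          rw [map_sub, Pi.sub_apply, hu S hS hj,
            cechD_cechD _ (fun h h' => cechRes_cechRes f h h'), sub_zero])
        (fun S hS hj => by rw [Pi.sub_apply, hv S hS hj, sub_self])
      refine ⟨v + w, fun S hS hj => ?_⟩
      rw [map_add, Pi.add_apply, ← hw S hS hj, Pi.sub_apply]
      abel
    intro j u hu hu0
    have hu' : ∀ S ⊆ A, S.card = j + 1 → ∑ a ∈ S, zsign ((S.filter (fun x => a < x)).card) •
        cechRes f E (Finset.insert_subset_insert b (Finset.erase_subset a S))
          (u (insert b (S.erase a))) = 0 := by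
      intro S hS hj
      have := hu (insert b S) (Finset.insert_subset_insert b hS)
        (by rw [Finset.card_insert_of_notMem (hbS S hS), hj])
      rwa [cechD_insert _ u S b (hlt S hS), hu0 S hS hj, map_zero, zero_sub, neg_eq_zero] at this
    -- clear the denominators in `b`
    obtain ⟨N, hN⟩ : ∃ N : ℕ, ∀ S : Finset ι, b ∉ S → ∃ y : CechObj f E S,
        f b ^ N • u (insert b S) = cechRes f E (Finset.subset_insert b S) y := by
      refine exists_uniform_exponent (fun S k l hkl h hS => ?_) fun S => ?_
      · obtain ⟨y, hy⟩ := h hS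
        obtain ⟨d, rfl⟩ := Nat.exists_eq_add_of_le' hkl
        exact ⟨f b ^ d • y, by rw [map_smul, ← hy, smul_smul, pow_add]⟩
      · by_cases hS : b ∈ S
        · exact ⟨0, fun h => absurd hS h⟩
        · have hl := isLocalizedModule_cechRes f (M := E) hS
          obtain ⟨⟨y, _, k, rfl⟩, hk⟩ := hl.surj (u (insert b S))
          exact ⟨k, fun _ => ⟨y, hk⟩⟩
    choose! y hy using hN
    have hy0 : ∀ S ⊆ A, S.card = j + 1 →
        cechRes f E (Finset.subset_insert b S) (cechD (cechRes f E) y S) = 0 := by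
      intro S hS hj
      rw [← smul_zero (f b ^ N), ← hu' S hS hj, cechD_apply, map_sum, Finset.smul_sum]
      refine Finset.sum_congr rfl fun a ha => ?_
      rw [map_zsmul, smul_comm, ← map_smul _ (f b ^ N),
        hy _ (hbS _ ((Finset.erase_subset a S).trans hS)), cechRes_cechRes, cechRes_cechRes]
    obtain ⟨K, hK⟩ : ∃ K : ℕ, ∀ S : Finset ι, S ⊆ A → S.card = j + 1 →
        f b ^ K • cechD (cechRes f E) y S = 0 := by
      refine exists_uniform_exponent (fun S k l hkl h hS hj => ?_) fun S => ?_
      · obtain ⟨d, rfl⟩ := Nat.exists_eq_add_of_le' hkl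
        rw [pow_add, mul_smul, h hS hj, smul_zero]
      · by_cases hS : S ⊆ A ∧ S.card = j + 1
        · have hl := isLocalizedModule_cechRes f (M := E) (hbS S hS.1)
          have h0 := hy0 S hS.1 hS.2
          rw [← map_zero (cechRes f E (Finset.subset_insert b S))] at h0
          obtain ⟨⟨_, k, rfl⟩, hk⟩ := hl.exists_of_eq h0
          exact ⟨k, fun _ _ => by simpa [Submonoid.smul_def] using hk⟩
        · exact ⟨0, fun h h' => absurd ⟨h, h'⟩ hS⟩
    have hz : ∀ S ⊆ A, S.card = j + 1 → cechD (cechRes f E) (f b ^ K • y) S = 0 := by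
      intro S hS hj
      rw [map_smul, Pi.smul_apply, hK S hS hj]
    have hzu : ∀ S ⊆ A, f b ^ (K + N) • u (insert b S) =
        cechRes f E (Finset.subset_insert b S) ((f b ^ K • y) S) := by
      intro S hS
      rw [Pi.smul_apply, map_smul, ← hy S (hbS S hS), smul_smul, pow_add]
    generalize f b ^ K • y = z at hz hzu
    generalize K + N = N' at hzu
    match j with
    | j + 1 =>
      obtain ⟨v, hv⟩ := ih j z hz
      have hw : ∀ T : Finset ι, ∃ w : CechObj f E T, (b ∉ T → w = 0) ∧
          (b ∈ T → f b ^ N' • w = -cechRes f E (Finset.erase_subset b T) (v (T.erase b))) := by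
        intro T
        by_cases hT : b ∈ T
        · obtain ⟨w, hw⟩ := (smul_pow_bijective f hT N').2
            (-cechRes f E (Finset.erase_subset b T) (v (T.erase b)))
          exact ⟨w, fun h => absurd hT h, fun _ => hw⟩
        · exact ⟨0, fun _ => rfl, fun h => absurd h hT⟩
      choose w hw0 hw using hw
      refine ⟨w, fun T hT hj => ?_⟩
      by_cases hbT : b ∈ T
      · obtain ⟨S, hbS', rfl⟩ : ∃ S, b ∉ S ∧ T = insert b S :=
          ⟨T.erase b, Finset.notMem_erase b T, (Finset.insert_erase hbT).symm⟩
        have hS : S ⊆ A := hsub S ((Finset.subset_insert b S).trans hT) hbS'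
        rw [Finset.card_insert_of_notMem hbS'] at hj
        apply (smul_pow_bijective f hbT N').1
        simp only
        rw [hzu S hS, hv S hS (by omega), cechD_insert _ w S b (hlt S hS), hw0 S hbS', map_zero,
          zero_sub, smul_neg, Finset.smul_sum, ← Finset.sum_neg_distrib, cechD_apply, map_sum]
        refine Finset.sum_congr rfl fun a ha => ?_
        rw [smul_comm, ← map_smul _ (f b ^ N'), hw _ (Finset.mem_insert_self _ _), map_zsmul,
          cechRes_cechRes, map_neg, zsmul_neg, neg_neg, cechRes_cechRes]
        congr 1
        exact restrict_congr _ v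
          (Finset.erase_insert (fun h => hbS' (Finset.mem_of_mem_erase h))).symm _ _
      · rw [hu0 T (hsub T hT hbT) hj, cechD_apply]
        refine (Finset.sum_eq_zero fun a ha => ?_).symm
        rw [hw0 _ (fun h => hbT (Finset.mem_of_mem_erase h)), map_zero, zsmul_zero]
    | 0 =>
      obtain ⟨e, he⟩ := (cechUnit_empty_bijective f (M := E)).2 (z ∅)
      have hea : ∀ a ∈ A, cechUnit f E {a} e = 0 := by
        intro a ha
        rw [← hz {a} (by simpa using ha) (by simp), cechD_singleton, ← he, cechRes_cechUnit]
      obtain ⟨k, hk⟩ : ∃ k : ℕ, ∀ a : ι, a ∈ A → f a ^ k • e = 0 := by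
        refine exists_uniform_exponent (fun a k l hkl h ha => ?_) fun a => ?_
        · obtain ⟨d, rfl⟩ := Nat.exists_eq_add_of_le' hkl
          rw [pow_add, mul_smul, h ha, smul_zero]
        · by_cases ha : a ∈ A
          · obtain ⟨k, hk⟩ := exists_pow_smul_eq_zero_of_cechUnit_eq_zero f (hea a ha)
            exact ⟨k, fun _ => hk⟩
          · exact ⟨0, fun h => absurd h ha⟩
      obtain ⟨e', s, he', hs⟩ := hE.exists_pow_smul_eq
        (Ideal.span ((fun a => f a ^ k) '' A)) (f b) e (fun x hx => by
          induction hx using Submodule.span_induction with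
          | mem x hx =>
            obtain ⟨a, ha, rfl⟩ := hx
            exact hk a ha
          | zero => exact zero_smul R e
          | add x y _ _ hx hy => rw [add_smul, hx, hy, add_zero]
          | smul r x _ hx => rw [smul_assoc, hx, smul_zero]) N'
      refine ⟨fun T => cechUnit f E T e', fun T hT hj => ?_⟩
      obtain ⟨a, rfl⟩ := Finset.card_eq_one.1 hj
      have hd : cechD (cechRes f E) (fun T => cechUnit f E T e') {a} = cechUnit f E {a} e' := by
        rw [cechD_singleton, cechRes_cechUnit]
      rw [hd]
      rcases Finset.mem_insert.1 (hT (Finset.mem_singleton_self a)) with rfl | ha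
      · apply (smul_pow_bijective f (Finset.mem_singleton_self a) (s + N')).1
        simp only
        rw [← map_smul, hs, map_smul, ← cechRes_cechUnit f (Finset.empty_subset {a}), he, pow_add,
          mul_smul]
        congr 1
        exact hzu ∅ (Finset.empty_subset _)
      · rw [hu0 {a} (by simpa using ha) hj, cechUnit_eq_zero_of_pow_smul_eq_zero f
          (Finset.mem_singleton_self a) (he' _ (Ideal.subset_span ⟨a, ha, rfl⟩))]

end Injective

section DimensionShifting

open CategoryTheory Limits

variable {R : Type} [CommRing R]

/-- The modules `R / J ^ t`. -/
abbrev quotientPow (J : Ideal R) (t : ℕ) : ModuleCat.{0} R := ModuleCat.of R (R ⧸ J ^ t)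

/-- The transition maps `R / J ^ s ⟶ R / J ^ t`. -/
abbrev quotientPowMap (J : Ideal R) (s t : ℕ) (h : t ≤ s) : quotientPow J s ⟶ quotientPow J t :=
  ModuleCat.ofHom (Submodule.mapQ (J ^ s) (J ^ t) LinearMap.id (Ideal.pow_le_pow_right h))

theorem exists_quotientPow_hom {M : ModuleCat.{0} R} (J : Ideal R) (t : ℕ) (m : M)
    (hm : ∀ x ∈ J ^ t, x • m = 0) :
    ∃ g : quotientPow J t ⟶ M, g.hom (Submodule.Quotient.mk 1) = m :=
  ⟨ModuleCat.ofHom (Submodule.liftQ (J ^ t) (LinearMap.toSpanSingleton R M m) hm), one_smul R m⟩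

theorem exists_pow_smul_eq_zero_of_forall {ι M : Type*} [Finite ι] [AddCommGroup M] [Module R M]
    (f : ι → R) (m : M) (h : ∀ i, ∃ k : ℕ, f i ^ k • m = 0) :
    ∃ t : ℕ, ∀ x ∈ Ideal.span (Set.range f) ^ t, x • m = 0 := by
  obtain ⟨t, ht⟩ := Ideal.exists_pow_le_of_le_radical_of_fg
    (I := Ideal.span (Set.range f)) (J := LinearMap.ker (LinearMap.toSpanSingleton R M m))
    (Ideal.span_le.2 (Set.range_subset_iff.2 h))
    (Submodule.fg_span (Set.finite_range f))
  exact ⟨t, fun x hx => ht hx⟩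

theorem exists_shortExact_injective (M : ModuleCat.{0} R) :
    ∃ S : ShortComplex (ModuleCat.{0} R), S.ShortExact ∧ Injective S.X₂ ∧ S.X₁ = M :=
  ⟨ShortComplex.mk (Injective.ι M) (cokernel.π (Injective.ι M)) (cokernel.condition _),
    { exact := ShortComplex.exact_cokernel _ },
    inferInstanceAs (Injective (Injective.under M)), rfl⟩

variable {ι : Type*} (f : ι → R)

/-- Functoriality of the terms of the Čech complex in the module. -/
def cechMap {M N : Type} [AddCommGroup M] [Module R M] [AddCommGroup N] [Module R N]
    (φ : M →ₗ[R] N) (S : Finset ι) : CechObj f M S →ₗ[R] CechObj f N S :=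
  φ.lTensor _

section

variable {M N : Type} [AddCommGroup M] [Module R M] [AddCommGroup N] [Module R N]
  (φ : M →ₗ[R] N)

theorem cechMap_injective (hφ : Function.Injective φ) (S : Finset ι) :
    Function.Injective (cechMap f φ S) :=
  have : Module.Flat R (Localization.Away (∏ i ∈ S, f i)) :=
    IsLocalization.flat _ (Submonoid.powers (∏ i ∈ S, f i))
  Module.Flat.lTensor_preserves_injective_linearMap φ hφ

theorem cechMap_cechRes {S T : Finset ι} (h : S ⊆ T) (x : CechObj f M S) :
    cechMap f φ T (cechRes f M h x) = cechRes f N h (cechMap f φ S x) := by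
  have : (cechMap f φ T) ∘ₗ (cechRes f M h) = (cechRes f N h) ∘ₗ (cechMap f φ S) :=
    (LinearMap.lTensor_comp_rTensor _ _ _).trans (LinearMap.rTensor_comp_lTensor _ _ _).symm
  exact LinearMap.congr_fun this x

theorem cechMap_cechUnit (S : Finset ι) (m : M) :
    cechMap f φ S (cechUnit f M S m) = cechUnit f N S (φ m) := by
  simp [cechMap, cechUnit]

theorem cechMap_cechD [LinearOrder ι] (u : ∀ S, CechObj f M S) (S : Finset ι) :
    cechMap f φ S (cechD (cechRes f M) u S) =
      cechD (cechRes f N) (fun T => cechMap f φ T (u T)) S := by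
  rw [cechD_apply, cechD_apply, map_sum]
  refine Finset.sum_congr rfl fun a ha => ?_
  rw [map_zsmul, cechMap_cechRes]

end

variable [LinearOrder ι] [Finite ι] [IsNoetherianRing R]

/-- Dimension shifting for the Čech complex along `0 → M → E → N → 0` with `E` injective. -/
theorem cech_exact_of_shortExact {M E N : Type} [AddCommGroup M] [Module R M] [AddCommGroup E]
    [Module R E] [AddCommGroup N] [Module R N] (φ : M →ₗ[R] E) (γ : E →ₗ[R] N)
    (hφ : Function.Injective φ) (hφγ : Function.Exact φ γ) (hγ : Function.Surjective γ)
    (hE : Module.Injective R E) (j : ℕ)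
    (hN : ∀ w : ∀ S, CechObj f N S, (∀ S, S.card = j + 1 → cechD (cechRes f N) w S = 0) →
      ∃ v : ∀ S, CechObj f E S, (∀ S, S.card = j → cechMap f γ S (v S) = w S) ∧
        ∀ S, S.card = j + 1 → cechD (cechRes f E) v S = 0)
    (u : ∀ S, CechObj f M S) (hu : ∀ S, S.card = j + 2 → cechD (cechRes f M) u S = 0) :
    ∃ v : ∀ S, CechObj f M S, ∀ S, S.card = j + 1 → u S = cechD (cechRes f M) v S := by
  have := Fintype.ofFinite ι
  have hex : ∀ S x, cechMap f γ S x = 0 ↔ ∃ y, cechMap f φ S y = x := fun S =>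
    lTensor_exact _ hφγ hγ
  obtain ⟨w, hw⟩ := cech_exact_of_injective f hE Finset.univ j (fun S => cechMap f φ S (u S))
    fun S _ hS => by rw [← cechMap_cechD, hu S hS, map_zero]
  obtain ⟨v, hv, hv0⟩ := hN (fun S => cechMap f γ S (w S)) fun S hS => by
    rw [← cechMap_cechD, ← hw S (Finset.subset_univ S) hS]
    exact (hex S _).2 ⟨_, rfl⟩
  have hy : ∀ S, ∃ y, S.card = j → cechMap f φ S y = (w - v) S := by
    intro S
    by_cases hS : S.card = j
    · obtain ⟨y, hy⟩ := (hex S ((w - v) S)).1 (by rw [Pi.sub_apply, map_sub, hv S hS, sub_self])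
      exact ⟨y, fun _ => hy⟩
    · exact ⟨0, fun h => absurd h hS⟩
  choose y hy using hy
  refine ⟨y, fun S hS => cechMap_injective f φ hφ S ?_⟩
  rw [cechMap_cechD, cechD_congr _ hy S hS, map_sub, Pi.sub_apply, hv0 S hS, sub_zero]
  exact hw S (Finset.subset_univ S) hS

/-- If the classes in `Ext^{j+1}(R / J ^ t, M)` eventually vanish, for `J` the ideal generated by
the `f i`, then the Čech complex of `M` is exact at the `(j+1)`-fold localizations. -/
theorem cech_exact (j : ℕ) : ∀ M : ModuleCat.{0} R,
    EventuallyExtZero (quotientPow (Ideal.span (Set.range f)))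
      (quotientPowMap (Ideal.span (Set.range f))) j M →
    ∀ u : ∀ S, CechObj f M S, (∀ S, S.card = j + 2 → cechD (cechRes f M) u S = 0) →
      ∃ v : ∀ S, CechObj f M S, ∀ S, S.card = j + 1 → u S = cechD (cechRes f M) v S := by
  induction j with
  | zero =>
    intro M hM
    obtain ⟨S, hS, hI, rfl⟩ := exists_shortExact_injective M
    refine cech_exact_of_shortExact f S.f.hom S.g.hom hS.moduleCat_injective_f
      ((ShortComplex.ShortExact.moduleCat_exact_iff_function_exact S).1 hS.exact)
      hS.moduleCat_surjective_g (Module.injective_module_of_injective_object R S.X₂) 0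
      fun w hw => ?_
    obtain ⟨m, hm⟩ := (cechUnit_empty_bijective f).2 (w ∅)
    obtain ⟨t, ht⟩ := exists_pow_smul_eq_zero_of_forall f m fun i =>
      exists_pow_smul_eq_zero_of_cechUnit_eq_zero f (by
        rw [← cechRes_cechUnit f (Finset.empty_subset {i}), hm, ← cechD_singleton,
          hw {i} (Finset.card_singleton i)])
    obtain ⟨g, rfl⟩ := exists_quotientPow_hom _ t m ht
    obtain ⟨s, hs, e, he⟩ := hM.exists_hom_comp_eq hS t g
    refine ⟨fun T => cechUnit f S.X₂ T (e.hom (Submodule.Quotient.mk 1)), fun T hT => ?_,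
      fun T hT => ?_⟩
    · obtain rfl := Finset.card_eq_zero.1 hT
      rw [← hm, cechMap_cechUnit]
      exact congrArg _ (congrArg (fun k => k.hom (Submodule.Quotient.mk 1)) he)
    · obtain ⟨i, rfl⟩ := Finset.card_eq_one.1 hT
      rw [cechD_singleton, cechRes_cechUnit]
      refine cechUnit_eq_zero_of_pow_smul_eq_zero f (Finset.mem_singleton_self i) (k := s) ?_
      rw [← map_smul, ← Submodule.Quotient.mk_smul, smul_eq_mul, mul_one,
        (Submodule.Quotient.mk_eq_zero _).2
          (Ideal.pow_mem_pow (Ideal.subset_span (Set.mem_range_self i)) s), map_zero]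
  | succ j ih =>
    intro M hM
    obtain ⟨S, hS, hI, rfl⟩ := exists_shortExact_injective M
    refine cech_exact_of_shortExact f S.f.hom S.g.hom hS.moduleCat_injective_f
      ((ShortComplex.ShortExact.moduleCat_exact_iff_function_exact S).1 hS.exact)
      hS.moduleCat_surjective_g (Module.injective_module_of_injective_object R S.X₂) (j + 1)
      fun w hw => ?_
    obtain ⟨v, hv⟩ := ih S.X₃ (hM.shift hS) w hw
    have hs : ∀ T, Function.Surjective (cechMap f S.g.hom T) := fun T =>
      LinearMap.lTensor_surjective _ hS.moduleCat_surjective_g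
    choose v' hv' using fun T => hs T (v T)
    refine ⟨cechD (cechRes f S.X₂) v', fun T hT => ?_,
      fun T hT => cechD_cechD _ (fun h h' => cechRes_cechRes f h h') v' T⟩
    rw [cechMap_cechD, hv T hT]
    exact congrArg (fun z => cechD (cechRes f S.X₃) z T) (funext hv')

end DimensionShifting

section MayerVietoris

open CategoryTheory

variable {R : Type} [CommRing R]

theorem eventuallyExtZero_of_subsingleton_localCohomology (J : Ideal R) (M : ModuleCat.{0} R)
    (j : ℕ) (h : Subsingleton ((localCohomology J (j + 1)).obj M)) :
    EventuallyExtZero (quotientPow J) (quotientPowMap J) j M := by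
  intro t z hz
  obtain ⟨e, he⟩ := ProjectiveResolution.exists_factor_of_ext M
    (projectiveResolution (quotientPow J t)) j z hz
  obtain ⟨s, hs, hse⟩ := localCohomology.exists_map_eq_zero J (j + 1) M h t e
  obtain ⟨ψ, hψ⟩ := he _ (projectiveResolution (quotientPow J s)) (quotientPowMap J s t hs) hse
  exact ⟨s, hs, ψ, hψ⟩

variable {ι : Type*} (f : ι → R)

/-- The restriction maps `R_{f_S} → R_{f_T}` for `S ⊆ T`. -/
def awayRes {S T : Finset ι} (h : S ⊆ T) :
    Localization.Away (∏ i ∈ S, f i) →ₗ[R] Localization.Away (∏ i ∈ T, f i) :=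
  (awayAlgHom (Finset.prod_dvd_prod_of_subset S T f h)).toLinearMap

theorem awayRes_awayRes {S T U : Finset ι} (h : S ⊆ T) (h' : T ⊆ U)
    (x : Localization.Away (∏ i ∈ S, f i)) :
    awayRes f h' (awayRes f h x) = awayRes f (h.trans h') x :=
  awayAlgHom_awayAlgHom (Finset.prod_dvd_prod_of_subset S T f h)
    (Finset.prod_dvd_prod_of_subset T U f h') x

variable [LinearOrder ι] [Finite ι] [IsNoetherianRing R]

/-- If `H^{j+1}_I(R)` vanishes, for `I` generated by the `f i`, then the Čech complex of
localizations is exact at the `(j+1)`-fold localizations. -/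
theorem away_exact (j : ℕ) (h : Subsingleton ((localCohomology (Ideal.span (Set.range f))
      (j + 1)).obj (ModuleCat.of R R)))
    (u : ∀ S : Finset ι, Localization.Away (∏ i ∈ S, f i))
    (hu : ∀ S, S.card = j + 2 → cechD (awayRes f) u S = 0) :
    ∃ v : ∀ S : Finset ι, Localization.Away (∏ i ∈ S, f i),
      ∀ S, S.card = j + 1 → u S = cechD (awayRes f) v S := by
  let e : ∀ S : Finset ι, CechObj f R S ≃ₗ[R] Localization.Away (∏ i ∈ S, f i) :=
    fun S => TensorProduct.rid R _
  have he : ∀ {S T : Finset ι} (h : S ⊆ T) (x : CechObj f R S),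
      e T (cechRes f R h x) = awayRes f h (e S x) := by
    intro S T h x
    exact LinearMap.congr_fun (f := (e T).toLinearMap ∘ₗ cechRes f R h)
      (g := awayRes f h ∘ₗ (e S).toLinearMap) (TensorProduct.ext' fun a b => by
        simp [e, cechRes, awayRes]) x
  have hD : ∀ (w : ∀ S, CechObj f R S) S,
      e S (cechD (cechRes f R) w S) = cechD (awayRes f) (fun T => e T (w T)) S := by
    intro w S
    simp_rw [cechD_apply, map_sum, map_zsmul, he]
  obtain ⟨v, hv⟩ := cech_exact f j (ModuleCat.of R R)
    (eventuallyExtZero_of_subsingleton_localCohomology _ _ j h) (fun S => (e S).symm (u S))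
    fun S hS => (e S).injective (by
      rw [map_zero, ← hu S hS]
      exact (hD _ S).trans (by simp))
  refine ⟨fun S => e S (v S), fun S hS => ?_⟩
  rw [← hD, ← (e S).apply_symm_apply (u S)]
  exact congrArg (e S) (hv S hS)

end MayerVietoris

section TotalComplex

variable {κ ι : Type*} [LinearOrder κ] [LinearOrder ι] {R : Type*} [CommRing R]
  {C : Finset ι → Type*} [∀ S, AddCommGroup (C S)] [∀ S, Module R (C S)]

/-- The differential of the total complex of the Čech complex of a system of modules with
operators `δ S l`, on families indexed by pairs of finite sets. -/
def totalD (ρ : ∀ {S T : Finset ι}, S ⊆ T → C S →ₗ[R] C T) (δ : ∀ S, κ → C S →+ C S)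
    (U : Finset κ → ∀ S, C S) (T : Finset κ) (S : Finset ι) : C S :=
  (∑ l ∈ T, zsign ((T.filter (fun x => x < l)).card) • δ S l (U (T.erase l) S)) +
    zsign T.card • cechD ρ (U T) S

variable (ρ : ∀ {S T : Finset ι}, S ⊆ T → C S →ₗ[R] C T) (δ : ∀ S, κ → C S →+ C S)

theorem totalD_add (U V : Finset κ → ∀ S, C S) (T : Finset κ) (S : Finset ι) :
    totalD ρ δ (U + V) T S = totalD ρ δ U T S + totalD ρ δ V T S := by
  simp only [totalD, Pi.add_apply, map_add, smul_add, Finset.sum_add_distrib]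
  abel

theorem totalD_sub (U V : Finset κ → ∀ S, C S) (T : Finset κ) (S : Finset ι) :
    totalD ρ δ (U - V) T S = totalD ρ δ U T S - totalD ρ δ V T S := by
  simp only [totalD, Pi.sub_apply, map_sub, smul_sub, Finset.sum_sub_distrib]
  abel

theorem totalD_totalD
    (hρ : ∀ {S T U : Finset ι} (h : S ⊆ T) (h' : T ⊆ U) (x : C S),
      ρ h' (ρ h x) = ρ (h.trans h') x)
    (hδρ : ∀ {S T : Finset ι} (h : S ⊆ T) (l : κ) (x : C S), δ T l (ρ h x) = ρ h (δ S l x))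
    (hδ : ∀ S l m (x : C S), δ S l (δ S m x) = δ S m (δ S l x))
    (U : Finset κ → ∀ S, C S) (T : Finset κ) (S : Finset ι) :
    totalD ρ δ (totalD ρ δ U) T S = 0 := by
  have h1 : ∑ l ∈ T, zsign ((T.filter (fun x => x < l)).card) •
      ∑ m ∈ T.erase l, zsign (((T.erase l).filter (fun x => x < m)).card) •
        δ S l (δ S m (U ((T.erase l).erase m) S)) = 0 :=
    sum_zsign_smul_sum_erase_eq_zero (fun x y => x < y)
      (fun l m hlm => by rw [not_lt]; exact ⟨le_of_lt, fun h => lt_of_le_of_ne h hlm⟩) T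
      (fun l m => δ S l (δ S m (U ((T.erase l).erase m) S)))
      (fun l _ m _ _ => by simp only [Finset.erase_right_comm, hδ])
  have h2 : ∀ l ∈ T, zsign ((T.erase l).card) = -zsign T.card := by
    intro l hl
    rw [← Finset.card_erase_add_one hl, Nat.cast_add, Nat.cast_one, zsign_add_one, neg_neg]
  have h3 : ∀ l (u : ∀ S, C S), δ S l (cechD ρ u S) = cechD ρ (fun S' => δ S' l (u S')) S := by
    intro l u
    simp_rw [cechD_apply, map_sum, map_zsmul, hδρ]
  have h4 : cechD ρ (totalD ρ δ U T) S =
      ∑ l ∈ T, zsign ((T.filter (fun x => x < l)).card) •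
        cechD ρ (fun S' => δ S' l (U (T.erase l) S')) S := by
    have : totalD ρ δ U T =
        (∑ l ∈ T, zsign ((T.filter (fun x => x < l)).card) •
          (fun S' => δ S' l (U (T.erase l) S') : ∀ S', C S')) + zsign T.card • cechD ρ (U T) := by
      ext S'
      simp [totalD]
    rw [this, map_add, map_sum, map_zsmul, Pi.add_apply, Pi.smul_apply, cechD_cechD ρ hρ, smul_zero,
      add_zero, Finset.sum_apply]
    simp_rw [map_zsmul, Pi.smul_apply]
  rw [totalD, h4]
  simp only [totalD, map_add, map_sum, map_zsmul, smul_add, Finset.sum_add_distrib, h1, h3,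
    zero_add]
  rw [Finset.smul_sum, ← Finset.sum_add_distrib]
  refine Finset.sum_eq_zero fun l hl => ?_
  rw [h2 l hl, neg_smul, smul_neg, smul_comm, neg_add_cancel]

/-- If the Čech complex is exact at the terms indexed by sets with more than `c` elements, then
the total complex is exact in degrees at least `c + 1` plus the number of operators. -/
theorem exists_totalD_eq [Fintype κ]
    (hρ : ∀ {S T U : Finset ι} (h : S ⊆ T) (h' : T ⊆ U) (x : C S),
      ρ h' (ρ h x) = ρ (h.trans h') x)
    (hδρ : ∀ {S T : Finset ι} (h : S ⊆ T) (l : κ) (x : C S), δ T l (ρ h x) = ρ h (δ S l x))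
    (hδ : ∀ S l m (x : C S), δ S l (δ S m x) = δ S m (δ S l x)) (c : ℕ)
    (hc : ∀ q, c ≤ q → ∀ u : ∀ S, C S, (∀ S, S.card = q + 2 → cechD ρ u S = 0) →
      ∃ v : ∀ S, C S, ∀ S, S.card = q + 1 → u S = cechD ρ v S)
    (N : ℕ) (hN : Fintype.card κ + c + 1 ≤ N) (U : Finset κ → ∀ S, C S)
    (hU : ∀ T S, T.card + S.card = N + 1 → totalD ρ δ U T S = 0) :
    ∃ V : Finset κ → ∀ S, C S, ∀ T S, T.card + S.card = N → totalD ρ δ V T S = U T S := by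
  suffices H : ∀ k, ∃ V : Finset κ → ∀ S, C S, ∀ T S, T.card + S.card = N → T.card < k →
      totalD ρ δ V T S = U T S by
    obtain ⟨V, hV⟩ := H (Fintype.card κ + 1)
    exact ⟨V, fun T S hTS => hV T S hTS (Nat.lt_succ_of_le T.card_le_univ)⟩
  intro k
  induction k with
  | zero => exact ⟨0, fun T S _ h => absurd h (Nat.not_lt_zero _)⟩
  | succ k ih =>
    obtain ⟨V, hV⟩ := ih
    by_cases hk : Fintype.card κ < k
    · exact ⟨V, fun T S hTS _ => hV T S hTS (T.card_le_univ.trans_lt hk)⟩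
    have hW : ∀ T : Finset κ, ∃ v : ∀ S, C S, T.card = k → ∀ S, T.card + S.card = N →
        (U - totalD ρ δ V) T S = cechD ρ v S := by
      intro T
      by_cases hT : T.card = k
      · obtain ⟨v, hv⟩ := hc (N - k - 1) (by omega) ((U - totalD ρ δ V) T) fun S hS => by
          have h := totalD_sub ρ δ U (totalD ρ δ V) T S
          rw [hU T S (by omega), totalD_totalD ρ δ hρ hδρ hδ, sub_zero, totalD,
            Finset.sum_eq_zero, zero_add] at h
          · have := congrArg (zsign T.card • ·) h
            simpa only [smul_smul, zsign_mul_self, one_smul, smul_zero] using this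
          · intro l hl
            have hl' := Finset.card_erase_add_one hl
            rw [Pi.sub_apply, Pi.sub_apply, hV _ S (by omega) (by omega), sub_self, map_zero,
              smul_zero]
        exact ⟨v, fun _ S hS => hv S (by omega)⟩
      · exact ⟨0, fun h => absurd h hT⟩
    choose v hv using hW
    refine ⟨V + fun T => if T.card = k then zsign k • v T else 0, fun T S hTS hT => ?_⟩
    rw [totalD_add]
    nth_rewrite 2 [totalD]
    rw [Finset.sum_eq_zero, zero_add]
    · by_cases hT' : T.card = k
      · rw [if_pos hT', hT', map_zsmul, Pi.smul_apply, smul_smul, zsign_mul_self, one_smul,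
          ← hv T hT' S hTS, Pi.sub_apply, Pi.sub_apply, add_sub_cancel]
      · rw [if_neg hT', map_zero, Pi.zero_apply, smul_zero, add_zero, hV T S hTS (by omega)]
    · intro l hl
      have hl' := Finset.card_erase_add_one hl
      rw [if_neg (by omega), Pi.zero_apply, map_zero, smul_zero]

end TotalComplex

section Leibniz

variable {R : Type*} [CommRing R]

theorem eq_zero_of_leibniz {p : R} {B : Type*} [CommRing B] (φ : Localization.Away p →+* B)
    (E : Localization.Away p → B) (hE : ∀ a b, E (a * b) = φ a * E b + E a * φ b)
    (h0 : ∀ a, E (algebraMap R _ a) = 0) (x : Localization.Away p) : E x = 0 := by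
  obtain ⟨n, a, ha⟩ := IsLocalization.Away.surj p x
  have h := hE x (algebraMap R _ (p ^ n))
  rw [map_pow, ha, ← map_pow, h0, h0, mul_zero, zero_add, map_pow] at h
  exact (((IsLocalization.Away.algebraMap_pow_isUnit (S := Localization.Away p) p n).map
    φ).mul_left_eq_zero).1 h.symm

end Leibniz

section PartialDerivatives

theorem pderiv_pderiv_comm {σ K : Type*} [CommRing K] (l m : σ) (p : MvPolynomial σ K) :
    MvPolynomial.pderiv l (MvPolynomial.pderiv m p) =
      MvPolynomial.pderiv m (MvPolynomial.pderiv l p) := by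
  classical
  let D : σ → Derivation K (MvPolynomial σ K) (MvPolynomial σ K) := MvPolynomial.pderiv
  have : ⁅D l, D m⁆ = 0 := by
    refine MvPolynomial.derivation_ext fun i => ?_
    rw [Derivation.commutator_apply]
    simp [D, MvPolynomial.pderiv_X, Pi.single_apply, apply_ite]
  have h := DFunLike.congr_fun this p
  rwa [Derivation.commutator_apply, Derivation.zero_apply, sub_eq_zero] at h

variable {n r : ℕ} {f : Fin r → Rp n}
  {DD : ∀ (S : Finset (Fin r)) (l : Fin n),
    Localization.Away (∏ i ∈ S, f i) → Localization.Away (∏ i ∈ S, f i)}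

theorem partialDerivative_awayRes
    (hleibniz : ∀ S l a b, DD S l (a * b) = a * DD S l b + DD S l a * b)
    (hcompat : ∀ S l (p : Rp n),
      DD S l (algebraMap (Rp n) (Localization.Away (∏ i ∈ S, f i)) p) =
        algebraMap (Rp n) (Localization.Away (∏ i ∈ S, f i)) (MvPolynomial.pderiv l p))
    {S T : Finset (Fin r)} (h : S ⊆ T) (l : Fin n) (x : Localization.Away (∏ i ∈ S, f i)) :
    DD T l (awayRes f h x) = awayRes f h (DD S l x) := by
  let φ := awayAlgHom (Finset.prod_dvd_prod_of_subset S T f h)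
  change DD T l (φ x) = φ (DD S l x)
  refine sub_eq_zero.1 (eq_zero_of_leibniz φ.toRingHom (fun x => DD T l (φ x) - φ (DD S l x))
    (fun a b => ?_) (fun a => ?_) x)
  · change DD T l (φ (a * b)) - φ (DD S l (a * b)) =
      φ a * (DD T l (φ b) - φ (DD S l b)) + (DD T l (φ a) - φ (DD S l a)) * φ b
    rw [map_mul, hleibniz, hleibniz, map_add, map_mul, map_mul]
    ring
  · rw [φ.commutes, hcompat, hcompat, φ.commutes, sub_self]

theorem partialDerivative_comm
    (hadd : ∀ S l a b, DD S l (a + b) = DD S l a + DD S l b)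
    (hleibniz : ∀ S l a b, DD S l (a * b) = a * DD S l b + DD S l a * b)
    (hcompat : ∀ S l (p : Rp n),
      DD S l (algebraMap (Rp n) (Localization.Away (∏ i ∈ S, f i)) p) =
        algebraMap (Rp n) (Localization.Away (∏ i ∈ S, f i)) (MvPolynomial.pderiv l p))
    (S : Finset (Fin r)) (l m : Fin n) (x : Localization.Away (∏ i ∈ S, f i)) :
    DD S l (DD S m x) = DD S m (DD S l x) := by
  refine sub_eq_zero.1 (eq_zero_of_leibniz (RingHom.id _)
    (fun x => DD S l (DD S m x) - DD S m (DD S l x)) (fun a b => ?_) (fun a => ?_) x)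
  · simp only [hleibniz, hadd, RingHom.id_apply]
    ring
  · simp only [hcompat, pderiv_pderiv_comm l m, sub_self]

variable (f) in
/-- The element of the total complex given by a family indexed by all pairs of finite sets. -/
def totMVOfFamily (U : Finset (Fin n) → ∀ S : Finset (Fin r), Localization.Away (∏ i ∈ S, f i))
    (i : ℤ) : TotMV n r f i :=
  fun _ T S => U T.1 S.1

theorem totMVD_totMVOfFamily (hadd : ∀ S l a b, DD S l (a + b) = DD S l a + DD S l b)
    (U : Finset (Fin n) → ∀ S : Finset (Fin r), Localization.Away (∏ i ∈ S, f i)) {i j : ℤ}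
    (hij : j = i + 1) {q : ℤ} (hq : 1 ≤ q) (T : Fsub n (j - q)) (S : MVIdx r q) :
    totMVD n r f DD i j (totMVOfFamily f U i) q T S =
      totalD (awayRes f) (fun S l => AddMonoidHom.mk' (DD S l) (hadd S l)) U T.1 S.1 := by
  subst hij
  refine (congrFun (congrFun (congrFun (dif_pos rfl) q) T) S).trans ?_
  rw [totalD, cechD_apply, T.2]
  congr 1
  · exact Finset.sum_attach T.1 fun l => zsign ((T.1.filter (fun x => x < l)).card) •
      DD S.1 l (U (T.1.erase l) S.1)
  · rw [dif_pos hq]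
    congr 1
    exact Finset.sum_attach S.1 fun a => zsign ((S.1.filter (fun x => a < x)).card) •
      awayRes f (Finset.erase_subset a S.1) (U T.1 (S.1.erase a))

end PartialDerivatives

/-- **Statement 5.** Let `f₁,…,f_r` generate a proper ideal `I ⊆ ℂ[x₁,…,xₙ]`
and let `c ≥ 1` be such that the local cohomology modules `H^j_I(R)` vanish
for `j > c` (i.e. `cd(f₁,…,f_r) ≤ c`).  Then
`H^i(Tot(Ω^•(Dₙ) ⊗_{Dₙ} MV^•(f₁,…,f_r))) = 0` for all `i ≥ n + c`.
(The `Dₙ`-module structure of the localizations `R_{f_I}` enters through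
their partial derivative operators `DD`, which are the unique operators that
are additive, satisfy the Leibniz rule and extend `∂_l` on `R`.) -/
theorem total_deRham_MayerVietoris_vanishing
    (n r : ℕ) (f : Fin r → Rp n)
    (hproper : Ideal.span (Set.range f) ≠ ⊤)
    (c : ℕ) (hc : 1 ≤ c)
    (hlc : ∀ j : ℕ, c < j →
      Subsingleton ((localCohomology (Ideal.span (Set.range f)) j).obj
        (ModuleCat.of (Rp n) (Rp n))))
    (DD : ∀ (S : Finset (Fin r)) (l : Fin n),
      Localization.Away (∏ i ∈ S, f i) → Localization.Away (∏ i ∈ S, f i))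
    (hadd : ∀ S l a b, DD S l (a + b) = DD S l a + DD S l b)
    (hleibniz : ∀ S l a b, DD S l (a * b) = a * DD S l b + DD S l a * b)
    (hcompat : ∀ S l (p : Rp n),
      DD S l (algebraMap (Rp n) (Localization.Away (∏ i ∈ S, f i)) p) =
        algebraMap (Rp n) (Localization.Away (∏ i ∈ S, f i))
          (MvPolynomial.pderiv l p)) :
    ∀ i : ℤ, (n : ℤ) + c ≤ i →
      ∀ x : TotMV n r f i, totMVD n r f DD i (i + 1) x = 0 →
        ∃ y : TotMV n r f (i - 1), totMVD n r f DD (i - 1) i y = x := by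
  intro i hi x hx
  obtain ⟨U, rfl⟩ : ∃ U, x = totMVOfFamily f U i := by
    refine ⟨fun T S => if h : (T.card : ℤ) = i - ((S.card : ℤ) - 1) ∧ S.Nonempty then
      x ((S.card : ℤ) - 1) ⟨T, h.1⟩ ⟨S, h.2, by ring⟩ else 0, ?_⟩
    funext q T S
    obtain ⟨T, hT⟩ := T
    obtain ⟨S, hS, hSq⟩ := S
    obtain rfl : q = (S.card : ℤ) - 1 := by omega
    have h : (T.card : ℤ) = i - ((S.card : ℤ) - 1) ∧ S.Nonempty := ⟨hT, hS⟩
    simp only [totMVOfFamily]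
    rw [dif_pos h]
  have hcard : ∀ T : Finset (Fin n), T.card ≤ n := fun T => T.card_le_univ.trans_eq (by simp)
  obtain ⟨V, hV⟩ := exists_totalD_eq (awayRes f)
    (fun S l => AddMonoidHom.mk' (DD S l) (hadd S l))
    (fun h h' x => awayRes_awayRes f h h' x)
    (fun h l x => partialDerivative_awayRes hleibniz hcompat h l x)
    (fun S l m x => partialDerivative_comm hadd hleibniz hcompat S l m x) c
    (fun q hq u hu => away_exact f q (hlc (q + 1) (Nat.lt_succ_of_le hq)) u hu)
    (i + 1).toNat (by rw [Fintype.card_fin]; omega) U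
    (fun T S hTS => by
      have hT := hcard T
      have hS : 0 < S.card := by omega
      have hT' : (T.card : ℤ) = i + 1 - ((S.card : ℤ) - 1) := by omega
      exact (totMVD_totMVOfFamily hadd U rfl (by omega) ⟨T, hT'⟩
        ⟨S, Finset.card_pos.1 hS, by ring⟩).symm.trans
        (congrFun (congrFun (congrFun hx ((S.card : ℤ) - 1)) _) _))
  refine ⟨totMVOfFamily f V (i - 1), ?_⟩
  funext q T S
  have hT := hcard T.1
  have hT' := T.2
  have hS' := S.2.2
  exact (totMVD_totMVOfFamily hadd V (by ring) (by omega) T S).trans (hV T.1 S.1 (by omega))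
end
end

section
/- Fix 0 ≤ d ≤ n. Let 0 → A → B → C → 0 be a short exact sequence of left D_n-modules given with presentations A = P_A/I_A, B = P_B/I_B, C = P_C/I_C by finitely generated free D_n-modules, and let a shift vector 𝔪_C for P_C be given. Then there exist an isomorphism B ≅ Q_B/I, where Q_B = P_A ⊕ P_C, compatible with the given maps A → B → C (the composite Q_B → B → C being induced by the projection to P_C followed by P_C → C), and shift vectors 𝔪_A for P_A and 𝔪_B = (𝔪_A, 𝔪_C) for Q_B, such that the sequence becomes V_d-strict: for every j ∈ ℤ the induced sequence of quotient filtrations 0 → F^j[𝔪_A](A) → F^j[𝔪_B](B) → F^j[𝔪_C](C) → 0 is exact. -/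
set_option synthInstance.maxHeartbeats 1000000
set_option maxHeartbeats 4000000
set_option linter.unusedVariables false

open scoped TensorProduct

noncomputable section

/-- The monomial `x^α ∂^β` in the Weyl algebra. -/
def wmono {n : ℕ} (α β : Fin n → ℕ) : Weyl n :=
  (List.ofFn fun i : Fin n => (wx i) ^ (α i)).prod *
    (List.ofFn fun i : Fin n => (wd i) ^ (β i)).prod

/-- The `V_d`-filtration `F^j(Dₙ)`: the `ℂ`-span of the monomials `x^α ∂^β`
with `|β_H| ≤ |α_H| + j`, where `|γ_H| = γ₁ + … + γ_d`. -/
def Vfil (n d : ℕ) (j : ℤ) : Submodule ℂ (Weyl n) :=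
  Submodule.span ℂ { w | ∃ α β : Fin n → ℕ,
    w = wmono α β ∧
    (∑ i : Fin n, if (i : ℕ) < d then (β i : ℤ) else 0) ≤
      (∑ i : Fin n, if (i : ℕ) < d then (α i : ℤ) else 0) + j }

/-- The shifted `V_d`-filtration `F^j[𝔪](A) = Σᵢ F^{j-𝔪(i)}(Dₙ)·eᵢ` on the free
module `A = Dₙ^m` with shift vector `𝔪`, as a set. -/
def VfilFree (n d : ℕ) {m : ℕ} (𝔪 : Fin m → ℤ) (j : ℤ) : Set (Fin m → Weyl n) :=
  { v | ∀ i, v i ∈ Vfil n d (j - 𝔪 i) }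

section ListProd
variable {R : Type*} [Ring R]

theorem mul_prod_ofFn_pow {M : Type*} [Monoid M] {n : ℕ} (f : Fin n → M)
    (hf : ∀ i j, Commute (f i) (f j)) (i : Fin n) (β : Fin n → ℕ) :
    f i * (List.ofFn fun j => f j ^ β j).prod =
      (List.ofFn fun j => f j ^ (β + Pi.single i 1 : Fin n → ℕ) j).prod := by
  induction n with
  | zero => exact i.elim0
  | succ n ih =>
    simp only [List.ofFn_succ, List.prod_cons]
    refine Fin.cases ?_ (fun k => ?_) i
    · simp [pow_succ', mul_assoc]
    · have h := ih (fun j => f j.succ) (fun _ _ => hf _ _) k (fun j => β j.succ)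
      have e : (fun j : Fin n => f j.succ ^ (β + Pi.single k.succ 1 : Fin (n + 1) → ℕ) j.succ) =
          fun j => f j.succ ^ ((fun j : Fin n => β j.succ) + Pi.single k 1 : Fin n → ℕ) j := by
        funext j; simp [Pi.single_apply]
      rw [e, ← h, ← mul_assoc, ((hf k.succ 0).pow_right _).eq, mul_assoc]
      simp

theorem mul_pow_eq_of_mul_eq_mul_add_one {D x : R} (h : D * x = x * D + 1) (k : ℕ) :
    D * x ^ k = x ^ k * D + k • x ^ (k - 1) := by
  induction k with
  | zero => simp
  | succ k ih =>
    rw [pow_succ', ← mul_assoc, h, add_mul, mul_assoc, ih]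
    rcases k with _ | k
    · simp
    · simp only [mul_add, mul_smul_comm, Nat.add_sub_cancel, one_mul, ← mul_assoc, ← pow_succ',
        succ_nsmul _ (k + 1)]
      abel

theorem commute_prod_ofFn_pow {M : Type*} [Monoid M] {n : ℕ} (f : Fin n → M) (D : M)
    (h : ∀ j, Commute D (f j)) (α : Fin n → ℕ) :
    Commute D (List.ofFn fun j => f j ^ α j).prod := by
  refine Commute.list_prod_right _ _ fun y hy => ?_
  obtain ⟨j, rfl⟩ := (List.mem_ofFn' _ _).1 hy
  exact (h j).pow_right _

theorem mul_prod_ofFn_pow_eq_add {n : ℕ} (f : Fin n → R) (D : R) (i : Fin n)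
    (hi : D * f i = f i * D + 1) (h : ∀ j, j ≠ i → Commute D (f j)) (α : Fin n → ℕ) :
    D * (List.ofFn fun j => f j ^ α j).prod =
      (List.ofFn fun j => f j ^ α j).prod * D +
        α i • (List.ofFn fun j => f j ^ (α - Pi.single i 1 : Fin n → ℕ) j).prod := by
  induction n with
  | zero => exact i.elim0
  | succ n ih =>
    simp only [List.ofFn_succ, List.prod_cons]
    revert hi h
    refine Fin.cases (fun hi h => ?_) (fun k hi h => ?_) i
    · have hc := commute_prod_ofFn_pow (fun j : Fin n => f j.succ) D
        (fun j => h _ (Fin.succ_ne_zero j)) (fun j => α j.succ)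
      rw [← mul_assoc, mul_pow_eq_of_mul_eq_mul_add_one hi, add_mul, mul_assoc, hc.eq]
      simp [mul_assoc]
    · have hk := ih (fun j => f j.succ) k hi
        (fun j hj => h _ fun e => hj (Fin.succ_injective _ e)) (fun j => α j.succ)
      have e : (fun j : Fin n => f j.succ ^ (α - Pi.single k.succ 1 : Fin (n + 1) → ℕ) j.succ) =
          fun j => f j.succ ^ ((fun j : Fin n => α j.succ) - Pi.single k 1 : Fin n → ℕ) j := by
        funext j; simp [Pi.single_apply]
      rw [e, ← mul_assoc, ((h 0 (Fin.succ_ne_zero k).symm).pow_right _).eq, mul_assoc, hk]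
      simp [mul_add, mul_assoc, -nsmul_eq_mul]

end ListProd

section Weyl

variable {n : ℕ}

theorem commute_wx (i j : Fin n) : Commute (wx i) (wx j) :=
  Subtype.ext <| LinearMap.ext fun p => mul_left_comm (MvPolynomial.X i) (MvPolynomial.X j) p

theorem pderiv_pderiv_comm_s3 (i j : Fin n) (p : Rp n) :
    MvPolynomial.pderiv i (MvPolynomial.pderiv j p) =
      MvPolynomial.pderiv j (MvPolynomial.pderiv i p) := by
  have h : ⁅MvPolynomial.pderiv (R := ℂ) i, MvPolynomial.pderiv j⁆ = 0 :=
    MvPolynomial.derivation_ext fun k => by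
      rw [Derivation.commutator_apply]
      simp [MvPolynomial.pderiv_X, Pi.single_apply, apply_ite]
  have hp := congrArg (fun D : Derivation ℂ (Rp n) (Rp n) => D p) h
  simpa [Derivation.commutator_apply, sub_eq_zero] using hp

theorem commute_wd (i j : Fin n) : Commute (wd i) (wd j) :=
  Subtype.ext <| LinearMap.ext fun p => pderiv_pderiv_comm_s3 i j p

theorem derOp_mul_mulOp_self (i : Fin n) : derOp i * mulOp i = mulOp i * derOp i + 1 :=
  LinearMap.ext fun p => by
    simp [derOp, mulOp, Derivation.leibniz]

theorem derOp_mul_mulOp_of_ne {i j : Fin n} (h : j ≠ i) :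
    derOp i * mulOp j = mulOp j * derOp i :=
  LinearMap.ext fun p => by
    simp [derOp, mulOp, Derivation.leibniz, MvPolynomial.pderiv_X_of_ne h]

theorem wd_mul_wx_self (i : Fin n) : wd i * wx i = wx i * wd i + 1 :=
  Subtype.ext (derOp_mul_mulOp_self i)

theorem commute_wd_wx {i j : Fin n} (h : j ≠ i) : Commute (wd i) (wx j) :=
  Subtype.ext (derOp_mul_mulOp_of_ne h)

theorem wx_mul_wmono (i : Fin n) (α β : Fin n → ℕ) :
    wx i * wmono α β = wmono (α + Pi.single i 1) β := by
  rw [wmono, ← mul_assoc, mul_prod_ofFn_pow _ commute_wx, wmono]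

theorem wd_mul_wmono (i : Fin n) (α β : Fin n → ℕ) :
    wd i * wmono α β =
      wmono α (β + Pi.single i 1) + α i • wmono (α - Pi.single i 1) β := by
  rw [wmono, ← mul_assoc, mul_prod_ofFn_pow_eq_add wx (wd i) i (wd_mul_wx_self i)
    (fun j hj => commute_wd_wx hj), add_mul, mul_assoc, mul_prod_ofFn_pow _ commute_wd, wmono,
    wmono, smul_mul_assoc]

/-- The generators `xᵢ` and `∂ᵢ` of the Weyl algebra, indexed by a sum type. -/
def wgen : Fin n ⊕ Fin n → Weyl n := Sum.elim wx wd

/-- The monomial `x^α ∂^β` whose exponents are packed as one function on a sum type. -/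
def wmonomial (ν : Fin n ⊕ Fin n →₀ ℕ) : Weyl n :=
  wmono (fun i => ν (Sum.inl i)) (fun i => ν (Sum.inr i))

/-- The `V_d`-order `|β_H| - |α_H|` of the monomial `x^α ∂^β`. -/
def vOrder (d : ℕ) (ν : Fin n ⊕ Fin n →₀ ℕ) : ℤ :=
  (∑ i : Fin n, if (i : ℕ) < d then (ν (Sum.inr i) : ℤ) else 0) -
    ∑ i : Fin n, if (i : ℕ) < d then (ν (Sum.inl i) : ℤ) else 0

@[simp]
theorem vOrder_zero (d : ℕ) : vOrder d (0 : Fin n ⊕ Fin n →₀ ℕ) = 0 := by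
  simp [vOrder]

theorem vOrder_add (d : ℕ) (μ ν : Fin n ⊕ Fin n →₀ ℕ) :
    vOrder d (μ + ν) = vOrder d μ + vOrder d ν := by
  have h (s : Fin n → Fin n ⊕ Fin n) :
      (∑ i : Fin n, if (i : ℕ) < d then (((μ + ν) (s i) : ℕ) : ℤ) else 0) =
        (∑ i : Fin n, if (i : ℕ) < d then (μ (s i) : ℤ) else 0) +
          ∑ i : Fin n, if (i : ℕ) < d then (ν (s i) : ℤ) else 0 := by
    rw [← Finset.sum_add_distrib]
    refine Finset.sum_congr rfl fun i _ => ?_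
    split_ifs <;> simp
  simp only [vOrder, h]
  ring

theorem vOrder_single_inl (d : ℕ) (i : Fin n) :
    vOrder d (Finsupp.single (Sum.inl i) 1) = if (i : ℕ) < d then -1 else 0 := by
  trans 0 - if (i : ℕ) < d then 1 else 0
  · refine congrArg₂ _ (Finset.sum_eq_zero fun k _ => by simp) ?_
    rw [Finset.sum_eq_single i (fun k _ hk => by simp [hk.symm]) (by simp)]
    simp
  · split_ifs <;> simp

theorem vOrder_single_inr (d : ℕ) (i : Fin n) :
    vOrder d (Finsupp.single (Sum.inr i) 1) = if (i : ℕ) < d then 1 else 0 := by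
  trans (if (i : ℕ) < d then 1 else 0) - 0
  · refine congrArg₂ _ ?_ (Finset.sum_eq_zero fun k _ => by simp)
    rw [Finset.sum_eq_single i (fun k _ hk => by simp [hk.symm]) (by simp)]
    simp
  · simp

theorem wmonomial_zero : wmonomial (0 : Fin n ⊕ Fin n →₀ ℕ) = 1 := by
  simp [wmonomial, wmono]

theorem Vfil_eq_span_wmonomial (d : ℕ) (j : ℤ) :
    Vfil n d j = Submodule.span ℂ (wmonomial '' {ν | vOrder d ν ≤ j}) := by
  refine congrArg _ (Set.ext fun w => ⟨?_, ?_⟩)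
  · rintro ⟨α, β, rfl, h⟩
    refine ⟨Finsupp.equivFunOnFinite.symm (Sum.elim α β), ?_, by simp [wmonomial]⟩
    simp only [Set.mem_ofPred_eq, vOrder, Finsupp.equivFunOnFinite_symm_apply_apply, Sum.elim_inl,
      Sum.elim_inr]
    linarith
  · rintro ⟨ν, h, rfl⟩
    refine ⟨_, _, rfl, ?_⟩
    simp only [Set.mem_ofPred_eq, vOrder] at h
    linarith

theorem wmonomial_mem_Vfil {d : ℕ} {j : ℤ} {ν : Fin n ⊕ Fin n →₀ ℕ} (h : vOrder d ν ≤ j) :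
    wmonomial ν ∈ Vfil n d j := by
  rw [Vfil_eq_span_wmonomial]
  exact Submodule.subset_span ⟨ν, h, rfl⟩

theorem Vfil_mono (d : ℕ) : Monotone (Vfil n d) := fun i j hij => by
  simp only [Vfil_eq_span_wmonomial]
  exact Submodule.span_mono (Set.image_mono fun ν (hν : _ ≤ i) => hν.trans hij)

/-- Multiplying a monomial by a generator gives the expected monomial, up to monomials dividing the
original one and having the same `V_d`-order as the leading term. -/
theorem wgen_mul_wmonomial (d : ℕ) (s : Fin n ⊕ Fin n) (ν : Fin n ⊕ Fin n →₀ ℕ) :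
    wgen s * wmonomial ν - wmonomial (ν + Finsupp.single s 1) ∈
      Submodule.span ℂ (wmonomial ''
        {ν' | ν' ≤ ν ∧ vOrder d ν' = vOrder d (ν + Finsupp.single s 1)}) := by
  rcases s with i | i
  · have h : wgen (Sum.inl i) * wmonomial ν = wmonomial (ν + Finsupp.single (Sum.inl i) 1) := by
      rw [wmonomial, wgen, Sum.elim_inl, wx_mul_wmono, wmonomial]
      congr 1 <;> funext k <;> simp [Finsupp.single_apply, Pi.single_apply, eq_comm]
    rw [h, sub_self]
    exact zero_mem _
  · have h : wgen (Sum.inr i) * wmonomial ν = wmonomial (ν + Finsupp.single (Sum.inr i) 1) +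
        ν (Sum.inl i) • wmonomial (ν - Finsupp.single (Sum.inl i) 1) := by
      rw [wmonomial, wgen, Sum.elim_inr, wd_mul_wmono, wmonomial, wmonomial]
      congr 3 <;> funext k <;> simp [Finsupp.single_apply, Pi.single_apply, eq_comm]
    rw [h, add_sub_cancel_left]
    by_cases h0 : ν (Sum.inl i) = 0
    · rw [h0, zero_smul]
      exact zero_mem _
    · rw [← Nat.cast_smul_eq_nsmul ℂ]
      refine Submodule.smul_mem _ _ (Submodule.subset_span ⟨_, ⟨tsub_le_self, ?_⟩, rfl⟩)
      have hle : Finsupp.single (Sum.inl i) 1 ≤ ν := by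
        rw [Finsupp.single_le_iff]
        exact Nat.one_le_iff_ne_zero.2 h0
      have h1 := vOrder_add d (ν - Finsupp.single (Sum.inl i) 1) (Finsupp.single (Sum.inl i) 1)
      rw [tsub_add_cancel_of_le hle] at h1
      rw [vOrder_single_inl] at h1
      rw [vOrder_add, vOrder_single_inr]
      split_ifs at h1 ⊢ <;> linarith

theorem wgen_mul_mem_Vfil {d : ℕ} (s : Fin n ⊕ Fin n) {j : ℤ} {w : Weyl n}
    (hw : w ∈ Vfil n d j) : wgen s * w ∈ Vfil n d (vOrder d (Finsupp.single s 1) + j) := by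
  rw [Vfil_eq_span_wmonomial] at hw
  induction hw using Submodule.span_induction with
  | mem w hw =>
    obtain ⟨ν, hν, rfl⟩ := hw
    have hν' : vOrder d (ν + Finsupp.single s 1) ≤ vOrder d (Finsupp.single s 1) + j := by
      rw [vOrder_add, add_comm]
      exact add_le_add_right hν _
    rw [← sub_add_cancel (wgen s * wmonomial ν) (wmonomial (ν + Finsupp.single s 1))]
    refine add_mem ?_ (wmonomial_mem_Vfil hν')
    rw [Vfil_eq_span_wmonomial]
    refine Submodule.span_mono (Set.image_mono ?_) (wgen_mul_wmonomial d s ν)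
    rintro ν' ⟨-, h⟩
    exact h.trans_le hν'
  | zero => rw [mul_zero]; exact zero_mem _
  | add x y _ _ hx hy => rw [mul_add]; exact add_mem hx hy
  | smul z x _ hx => rw [mul_smul_comm]; exact Submodule.smul_mem _ _ hx

/-- Left multiplication by `q` raises the `V_d`-order by at most `r`. -/
def ShiftsVfil (d : ℕ) (r : ℤ) (q : Weyl n) : Prop :=
  ∀ ⦃j : ℤ⦄ ⦃w : Weyl n⦄, w ∈ Vfil n d j → q * w ∈ Vfil n d (r + j)

theorem ShiftsVfil.one (d : ℕ) : ShiftsVfil d 0 (1 : Weyl n) := fun j w hw => by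
  rwa [one_mul, zero_add]

theorem ShiftsVfil.mul {d : ℕ} {r r' : ℤ} {q q' : Weyl n} (h : ShiftsVfil d r q)
    (h' : ShiftsVfil d r' q') : ShiftsVfil d (r + r') (q * q') := fun j w hw => by
  rw [mul_assoc, add_assoc]
  exact h (h' hw)

theorem ShiftsVfil.pow {d : ℕ} {r : ℤ} {q : Weyl n} (h : ShiftsVfil d r q) (k : ℕ) :
    ShiftsVfil d (k * r) (q ^ k) := by
  induction k with
  | zero => simpa using ShiftsVfil.one d
  | succ k ih =>
    rw [pow_succ, Nat.cast_succ, add_mul, one_mul]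
    exact ih.mul h

theorem ShiftsVfil.prod_ofFn {d m : ℕ} {r : Fin m → ℤ} {f : Fin m → Weyl n}
    (h : ∀ i, ShiftsVfil d (r i) (f i)) : ShiftsVfil d (∑ i, r i) (List.ofFn f).prod := by
  induction m with
  | zero => simpa using ShiftsVfil.one d
  | succ m ih =>
    rw [List.ofFn_succ, List.prod_cons, Fin.sum_univ_succ]
    exact (h 0).mul (ih fun i => h i.succ)

theorem shiftsVfil_wmonomial (d : ℕ) (ν : Fin n ⊕ Fin n →₀ ℕ) :
    ShiftsVfil d (vOrder d ν) (wmonomial ν) := by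
  have hν : vOrder d ν =
      (∑ i : Fin n, (ν (Sum.inl i) : ℤ) * vOrder d (Finsupp.single (Sum.inl i) 1)) +
        ∑ i : Fin n, (ν (Sum.inr i) : ℤ) * vOrder d (Finsupp.single (Sum.inr i) 1) := by
    rw [vOrder, sub_eq_add_neg, add_comm, ← Finset.sum_neg_distrib]
    congr 1 <;> refine Finset.sum_congr rfl fun i _ => ?_
    · rw [vOrder_single_inl]
      split_ifs <;> simp
    · rw [vOrder_single_inr]
      split_ifs <;> simp
  rw [hν]
  exact (ShiftsVfil.prod_ofFn fun i : Fin n =>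
      ShiftsVfil.pow (fun j w => wgen_mul_mem_Vfil (d := d) (Sum.inl i)) (ν (Sum.inl i))).mul
    (ShiftsVfil.prod_ofFn fun i : Fin n =>
      ShiftsVfil.pow (fun j w => wgen_mul_mem_Vfil (d := d) (Sum.inr i)) (ν (Sum.inr i)))

theorem mul_mem_Vfil {d : ℕ} {i j : ℤ} {q w : Weyl n} (hq : q ∈ Vfil n d i)
    (hw : w ∈ Vfil n d j) : q * w ∈ Vfil n d (i + j) := by
  rw [Vfil_eq_span_wmonomial] at hq
  induction hq using Submodule.span_induction with
  | mem q hq =>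
    obtain ⟨ν, hν, rfl⟩ := hq
    exact Vfil_mono d (add_le_add_left hν j) (shiftsVfil_wmonomial d ν hw)
  | zero => rw [zero_mul]; exact zero_mem _
  | add x y _ _ hx hy => rw [add_mul]; exact add_mem hx hy
  | smul z x _ hx => rw [smul_mul_assoc]; exact Submodule.smul_mem _ _ hx

theorem one_mem_Vfil (d : ℕ) : (1 : Weyl n) ∈ Vfil n d 0 := by
  rw [← wmonomial_zero]
  exact wmonomial_mem_Vfil (vOrder_zero d).le

theorem wgen_mem_Vfil (d : ℕ) (s : Fin n ⊕ Fin n) :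
    wgen s ∈ Vfil n d (vOrder d (Finsupp.single s 1)) := by
  simpa using wgen_mul_mem_Vfil s (one_mem_Vfil (n := n) d)

/-- The `V_d`-filtration is exhaustive. -/
theorem exists_mem_Vfil (d : ℕ) (w : Weyl n) : ∃ j, w ∈ Vfil n d j := by
  have hw : w ∈ Algebra.adjoin ℂ ((↑) ⁻¹' (Set.range (mulOp (n := n)) ∪ Set.range derOp) :
      Set (Weyl n)) :=
    (Algebra.adjoin_adjoin_coe_preimage (R := ℂ)
      (s := Set.range (mulOp (n := n)) ∪ Set.range derOp)).ge (Algebra.mem_top (x := w))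
  induction hw using Algebra.adjoin_induction with
  | mem x hx =>
    rcases hx with ⟨i, hi⟩ | ⟨i, hi⟩
    · rw [← show wx i = x from Subtype.ext hi]
      exact ⟨_, wgen_mem_Vfil d (Sum.inl i)⟩
    · rw [← show wd i = x from Subtype.ext hi]
      exact ⟨_, wgen_mem_Vfil d (Sum.inr i)⟩
  | algebraMap z =>
    rw [Algebra.algebraMap_eq_smul_one]
    exact ⟨0, Submodule.smul_mem _ z (one_mem_Vfil d)⟩
  | add x y hx hy ihx ihy =>
    obtain ⟨i, hi⟩ := ihx
    obtain ⟨j, hj⟩ := ihy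
    exact ⟨max i j, add_mem (Vfil_mono d (le_max_left i j) hi) (Vfil_mono d (le_max_right i j) hj)⟩
  | mul x y hx hy ihx ihy =>
    obtain ⟨i, hi⟩ := ihx
    obtain ⟨j, hj⟩ := ihy
    exact ⟨i + j, mul_mem_Vfil hi hj⟩

end Weyl

section StandardBasis

universe u

theorem eq_zero_or_exists_mem_span_le {k M ι κ : Type*} [Semiring k] [AddCommMonoid M] [Module k M]
    [LinearOrder κ] (T : ι → M) (key : ι → κ) (S : Set ι) {v : M}
    (hv : v ∈ Submodule.span k (T '' S)) :
    v = 0 ∨ ∃ i ∈ S, v ∈ Submodule.span k (T '' {j ∈ S | key j ≤ key i}) := by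
  have hmono {i i' : ι} (h : key i ≤ key i') :
      Submodule.span k (T '' {j ∈ S | key j ≤ key i}) ≤
        Submodule.span k (T '' {j ∈ S | key j ≤ key i'}) :=
    Submodule.span_mono (Set.image_mono fun j hj => ⟨hj.1, hj.2.trans h⟩)
  induction hv using Submodule.span_induction with
  | mem x hx =>
    obtain ⟨i, hi, rfl⟩ := hx
    exact Or.inr ⟨i, hi, Submodule.subset_span ⟨i, ⟨hi, le_rfl⟩, rfl⟩⟩
  | zero => exact Or.inl rfl
  | add x y _ _ hx hy =>
    rcases hx with rfl | ⟨i, hi, hx⟩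
    · rwa [zero_add]
    rcases hy with rfl | ⟨j, hj, hy⟩
    · rw [add_zero]
      exact Or.inr ⟨i, hi, hx⟩
    rcases le_total (key i) (key j) with h | h
    · exact Or.inr ⟨j, hj, add_mem (hmono h hx) hy⟩
    · exact Or.inr ⟨i, hi, add_mem hx (hmono h hy)⟩
  | smul a x _ hx =>
    rcases hx with rfl | ⟨i, hi, hx⟩
    · exact Or.inl (smul_zero a)
    · exact Or.inr ⟨i, hi, Submodule.smul_mem _ a hx⟩

theorem nonempty_monomialOrder (σ : Type u) [Finite σ] :
    Nonempty (MonomialOrder.{u, u} σ) := by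
  classical
  let _ : LinearOrder σ := linearOrderOfSTO WellOrderingRel
  exact ⟨MonomialOrder.lex⟩

variable {n c : ℕ}

/-- The monomial `x^α ∂^β eᵢ` of the free module. -/
def vecMonomial (N : (Fin n ⊕ Fin n →₀ ℕ) × Fin c) : Fin c → Weyl n :=
  Pi.single N.2 (wmonomial N.1)

/-- The shifted `V_d`-order of a monomial of the free module. -/
def vecOrder (d : ℕ) (𝔪 : Fin c → ℤ) (N : (Fin n ⊕ Fin n →₀ ℕ) × Fin c) : ℤ :=
  vOrder d N.1 + 𝔪 N.2

/-- The monomials of the free module, ordered term over position. -/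
def vecKey (mo : MonomialOrder (Fin n ⊕ Fin n)) (N : (Fin n ⊕ Fin n →₀ ℕ) × Fin c) :
    mo.syn ×ₗ Fin c :=
  toLex (mo.toSyn N.1, N.2)

/-- The span of the monomials of order at most `j` that are smaller than `M`. -/
def lowerSpan (d : ℕ) (𝔪 : Fin c → ℤ) (mo : MonomialOrder (Fin n ⊕ Fin n))
    (M : (Fin n ⊕ Fin n →₀ ℕ) × Fin c) (j : ℤ) : Submodule ℂ (Fin c → Weyl n) :=
  Submodule.span ℂ (vecMonomial '' {N | vecKey mo N < vecKey mo M ∧ vecOrder d 𝔪 N ≤ j})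

theorem vecKey_injective (mo : MonomialOrder (Fin n ⊕ Fin n)) :
    Function.Injective (vecKey (c := c) mo) := by
  rintro ⟨ν, i⟩ ⟨ν', i'⟩ h
  simpa [vecKey] using h

theorem vecKey_add_lt_vecKey_add (mo : MonomialOrder (Fin n ⊕ Fin n))
    {N M : (Fin n ⊕ Fin n →₀ ℕ) × Fin c} (h : vecKey mo N < vecKey mo M)
    (μ : Fin n ⊕ Fin n →₀ ℕ) : vecKey mo (N.1 + μ, N.2) < vecKey mo (M.1 + μ, M.2) := by
  simp only [vecKey, Prod.Lex.toLex_lt_toLex, map_add] at h ⊢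
  simpa using h

theorem vecKey_lt_add_of_le (mo : MonomialOrder (Fin n ⊕ Fin n)) {ν ν' μ : Fin n ⊕ Fin n →₀ ℕ}
    (i : Fin c) (h : ν' ≤ ν) (hμ : μ ≠ 0) : vecKey mo (ν', i) < vecKey mo (ν + μ, i) := by
  refine Prod.Lex.toLex_lt_toLex.2 (Or.inl ?_)
  refine (mo.toSyn_monotone h).trans_lt ?_
  rw [map_add]
  refine lt_add_of_pos_right _ (lt_of_le_of_ne (mo.zero_le _) ?_)
  exact fun h => hμ ((map_eq_zero_iff _ mo.toSyn.injective).1 h.symm)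

variable {d : ℕ} {𝔪 : Fin c → ℤ} {mo : MonomialOrder (Fin n ⊕ Fin n)}

theorem lowerSpan_mono (M : (Fin n ⊕ Fin n →₀ ℕ) × Fin c) :
    Monotone (lowerSpan d 𝔪 mo M) := fun _ _ h =>
  Submodule.span_mono (Set.image_mono fun _ hN => ⟨hN.1, hN.2.trans h⟩)

theorem wgen_smul_vecMonomial (s : Fin n ⊕ Fin n) (N : (Fin n ⊕ Fin n →₀ ℕ) × Fin c) {j : ℤ}
    (hj : vecOrder d 𝔪 N ≤ j) :
    wgen s • vecMonomial N - vecMonomial (N.1 + Finsupp.single s 1, N.2) ∈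
      lowerSpan d 𝔪 mo (N.1 + Finsupp.single s 1, N.2) (vOrder d (Finsupp.single s 1) + j) := by
  have h := Submodule.mem_map_of_mem (f := LinearMap.single ℂ (fun _ : Fin c => Weyl n) N.2)
    (wgen_mul_wmonomial d s N.1)
  rw [map_sub, Submodule.map_span, ← Set.image_comp] at h
  have e : wgen s • vecMonomial N =
      LinearMap.single ℂ (fun _ : Fin c => Weyl n) N.2 (wgen s * wmonomial N.1) := by
    rw [vecMonomial, ← Pi.single_smul, smul_eq_mul]
    rfl
  rw [e]
  refine Submodule.span_mono ?_ h
  rintro _ ⟨ν', ⟨hle, ho⟩, rfl⟩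
  refine ⟨(ν', N.2), ⟨vecKey_lt_add_of_le mo _ hle (by simp), ?_⟩, rfl⟩
  simp only [vecOrder, ho, vOrder_add] at hj ⊢
  linarith

theorem wgen_smul_mem_lowerSpan (s : Fin n ⊕ Fin n) (M : (Fin n ⊕ Fin n →₀ ℕ) × Fin c) {j : ℤ}
    {w : Fin c → Weyl n} (hw : w ∈ lowerSpan d 𝔪 mo M j) :
    wgen s • w ∈
      lowerSpan d 𝔪 mo (M.1 + Finsupp.single s 1, M.2) (vOrder d (Finsupp.single s 1) + j) := by
  induction hw using Submodule.span_induction with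
  | mem w hw =>
    obtain ⟨N, ⟨hlt, ho⟩, rfl⟩ := hw
    have hlt' := vecKey_add_lt_vecKey_add mo hlt (Finsupp.single s 1)
    rw [← sub_add_cancel (wgen s • vecMonomial N) (vecMonomial (N.1 + Finsupp.single s 1, N.2))]
    refine add_mem (Submodule.span_mono (Set.image_mono ?_)
      (wgen_smul_vecMonomial (mo := mo) s N ho)) (Submodule.subset_span ⟨_, ⟨hlt', ?_⟩, rfl⟩)
    · exact fun N' hN' => ⟨hN'.1.trans hlt', hN'.2⟩
    · simp only [vecOrder, vOrder_add] at ho ⊢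
      linarith
  | zero => rw [smul_zero]; exact zero_mem _
  | add x y _ _ hx hy => rw [smul_add]; exact add_mem hx hy
  | smul z x _ hx => rw [smul_comm]; exact Submodule.smul_mem _ _ hx

/-- Some operator of order `vOrder d μ` translates leading monomials by `μ`. -/
def TranslatesLeading (d : ℕ) (𝔪 : Fin c → ℤ) (mo : MonomialOrder (Fin n ⊕ Fin n))
    (μ : Fin n ⊕ Fin n →₀ ℕ) : Prop :=
  ∃ q ∈ Vfil n d (vOrder d μ), ∀ (M : (Fin n ⊕ Fin n →₀ ℕ) × Fin c) (j : ℤ)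
    (w : Fin c → Weyl n), vecOrder d 𝔪 M ≤ j → w - vecMonomial M ∈ lowerSpan d 𝔪 mo M j →
    q • w - vecMonomial (M.1 + μ, M.2) ∈ lowerSpan d 𝔪 mo (M.1 + μ, M.2) (vOrder d μ + j)

theorem TranslatesLeading.zero : TranslatesLeading d 𝔪 mo 0 := by
  refine ⟨1, by simpa using one_mem_Vfil d, fun M j w _ hw => ?_⟩
  rw [one_smul, add_zero, vOrder_zero, zero_add]
  exact hw

theorem TranslatesLeading.add {μ μ' : Fin n ⊕ Fin n →₀ ℕ} (h : TranslatesLeading d 𝔪 mo μ)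
    (h' : TranslatesLeading d 𝔪 mo μ') : TranslatesLeading d 𝔪 mo (μ + μ') := by
  obtain ⟨q, hq, H⟩ := h
  obtain ⟨q', hq', H'⟩ := h'
  refine ⟨q * q', vOrder_add d μ μ' ▸ mul_mem_Vfil hq hq', fun M j w hj hw => ?_⟩
  have h := H _ _ _ ?_ (H' M j w hj hw)
  · rw [mul_smul, vOrder_add, add_assoc, add_comm μ μ', ← add_assoc M.1]
    exact h
  · simp only [vecOrder, vOrder_add] at hj ⊢
    linarith

theorem TranslatesLeading.single_one (s : Fin n ⊕ Fin n) :
    TranslatesLeading d 𝔪 mo (Finsupp.single s 1) := by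
  refine ⟨wgen s, wgen_mem_Vfil d s, fun M j w hj hw => ?_⟩
  have h := add_mem (wgen_smul_mem_lowerSpan s M hw) (wgen_smul_vecMonomial s M hj)
  rwa [smul_sub, sub_add_sub_cancel] at h

theorem translatesLeading (μ : Fin n ⊕ Fin n →₀ ℕ) : TranslatesLeading d 𝔪 mo μ := by
  induction μ using Finsupp.induction_linear with
  | zero => exact .zero
  | add μ μ' h h' => exact h.add h'
  | single s k =>
    induction k with
    | zero => rw [Finsupp.single_zero]; exact .zero
    | succ k ih => rw [Finsupp.single_add]; exact ih.add (.single_one s)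

theorem mem_span_vecMonomial_of_mem_VfilFree {j : ℤ} {v : Fin c → Weyl n}
    (hv : v ∈ VfilFree n d 𝔪 j) :
    v ∈ Submodule.span ℂ (vecMonomial '' {N | vecOrder d 𝔪 N ≤ j}) := by
  rw [← Finset.univ_sum_single v]
  refine sum_mem fun i _ => ?_
  have hi := hv i
  rw [Vfil_eq_span_wmonomial] at hi
  have h := Submodule.mem_map_of_mem (f := LinearMap.single ℂ (fun _ : Fin c => Weyl n) i) hi
  rw [Submodule.map_span, ← Set.image_comp] at h
  refine Submodule.span_mono ?_ h
  rintro _ ⟨ν, hν, rfl⟩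
  exact ⟨(ν, i), show vOrder d ν + 𝔪 i ≤ j from le_sub_iff_add_le.1 hν, rfl⟩

theorem exists_smul_vecMonomial_add {M : (Fin n ⊕ Fin n →₀ ℕ) × Fin c} {j : ℤ}
    {v : Fin c → Weyl n}
    (hv : v ∈ Submodule.span ℂ (vecMonomial ''
      {N | vecOrder d 𝔪 N ≤ j ∧ vecKey mo N ≤ vecKey mo M})) :
    ∃ z : ℂ, v - z • vecMonomial M ∈ lowerSpan d 𝔪 mo M j := by
  have h : v ∈ Submodule.span ℂ (insert (vecMonomial M)
      (vecMonomial '' {N | vecKey mo N < vecKey mo M ∧ vecOrder d 𝔪 N ≤ j})) := by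
    refine Submodule.span_mono ?_ hv
    rintro _ ⟨N, ⟨ho, hle⟩, rfl⟩
    rcases hle.eq_or_lt with h | h
    · exact Or.inl (congrArg _ (vecKey_injective mo h))
    · exact Or.inr ⟨N, ⟨h, ho⟩, rfl⟩
  obtain ⟨z, y, hy, rfl⟩ := Submodule.mem_span_insert.1 h
  exact ⟨z, by rwa [add_sub_cancel_left]⟩

/-- Every submodule of a free module over the Weyl algebra has a finite standard basis for the
`V_d`-filtration. -/
theorem exists_finite_standard_basis (d : ℕ) (𝔪 : Fin c → ℤ)
    (I : Submodule (Weyl n) (Fin c → Weyl n)) :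
    ∃ s : Set ((Fin c → Weyl n) × ℤ), s.Finite ∧ (∀ p ∈ s, p.1 ∈ I) ∧
      ∀ j, ∀ v ∈ VfilFree n d 𝔪 j, v ∈ I →
        v ∈ Submodule.span ℂ {w | ∃ p ∈ s, ∃ q ∈ Vfil n d (j - p.2), w = q • p.1} := by
  obtain ⟨mo⟩ := nonempty_monomialOrder (Fin n ⊕ Fin n)
  let E (i : Fin c) : Set ((Fin n ⊕ Fin n →₀ ℕ) × ℕ) :=
    {x | ∃ g ∈ I, g - vecMonomial (x.1, i) ∈
      lowerSpan d 𝔪 mo (x.1, i) (vecOrder d 𝔪 (x.1, i) + x.2)}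
  have hE : ∀ (i : Fin c) (x : (Fin n ⊕ Fin n →₀ ℕ) × ℕ), ∃ g, x ∈ E i → g ∈ I ∧
      g - vecMonomial (x.1, i) ∈ lowerSpan d 𝔪 mo (x.1, i) (vecOrder d 𝔪 (x.1, i) + x.2) := by
    intro i x
    by_cases hx : x ∈ E i
    · obtain ⟨g, hg⟩ := hx
      exact ⟨g, fun _ => hg⟩
    · exact ⟨0, fun h => absurd h hx⟩
  choose g hg using hE
  refine ⟨⋃ i, (fun x => (g i x, vecOrder d 𝔪 (x.1, i) + x.2)) '' {x | Minimal (· ∈ E i) x},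
    Set.finite_iUnion fun i => (WellQuasiOrderedLE.finite_of_isAntichain
      (setOfPred_minimal_antichain _)).image _, ?_, fun j v hv hvI => ?_⟩
  · simp only [Set.mem_iUnion]
    rintro _ ⟨i, x, hx, rfl⟩
    exact (hg i x hx.prop).1
  set S := Submodule.span ℂ {w | ∃ p ∈ ⋃ i, (fun x => (g i x, vecOrder d 𝔪 (x.1, i) + (x.2 : ℤ))) ''
    {x | Minimal (· ∈ E i) x}, ∃ q ∈ Vfil n d (j - p.2), w = q • p.1} with hS
  have key : ∀ (κ : mo.syn ×ₗ Fin c) (M : (Fin n ⊕ Fin n →₀ ℕ) × Fin c), vecKey mo M = κ →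
      vecOrder d 𝔪 M ≤ j → ∀ v ∈ I, v ∈ Submodule.span ℂ (vecMonomial ''
        {N | vecOrder d 𝔪 N ≤ j ∧ vecKey mo N ≤ vecKey mo M}) → v ∈ S := by
    intro κ
    induction κ using WellFoundedLT.induction with
    | _ κ ih =>
    rintro M rfl hMj v hvI hv
    have hlow : ∀ w ∈ I, w ∈ lowerSpan d 𝔪 mo M j → w ∈ S := by
      intro w hwI hw
      rcases eq_zero_or_exists_mem_span_le _ (vecKey mo) _ hw with rfl | ⟨M', hM', hw'⟩
      · exact zero_mem _
      · refine ih _ hM'.1 M' rfl hM'.2 w hwI (Submodule.span_mono (Set.image_mono ?_) hw')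
        exact fun N hN => ⟨hN.1.2, hN.2⟩
    obtain ⟨z, hz⟩ := exists_smul_vecMonomial_add hv
    rcases eq_or_ne z 0 with rfl | hz0
    · rw [zero_smul, sub_zero] at hz
      exact hlow v hvI hz
    obtain ⟨ν, i⟩ := M
    obtain ⟨k, hk⟩ := Int.le.dest hMj
    have hmem : (ν, k) ∈ E i := by
      refine ⟨z⁻¹ • v, ?_, ?_⟩
      · rw [← algebraMap_smul (Weyl n)]
        exact I.smul_mem _ hvI
      · have h := Submodule.smul_mem _ z⁻¹ hz
        rwa [smul_sub, smul_smul, inv_mul_cancel₀ hz0, one_smul, ← hk] at h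
    obtain ⟨⟨ν₀, k₀⟩, hle, hmin⟩ := (Set.isPWO_of_wellQuasiOrderedLE (E i)).exists_le_minimal hmem
    obtain ⟨hgI, hglow⟩ := hg i _ hmin.prop
    obtain ⟨hν, hk₀⟩ := Prod.mk_le_mk.1 hle
    obtain ⟨q, hq, H⟩ := translatesLeading (d := d) (𝔪 := 𝔪) (mo := mo) (ν - ν₀)
    have hqg := H _ _ _ (by simp) hglow
    have hord : vOrder d ν = vOrder d ν₀ + vOrder d (ν - ν₀) := by
      rw [← vOrder_add, add_tsub_cancel_of_le hν]
    have hk₀' : (k₀ : ℤ) ≤ k := Int.ofNat_le.2 hk₀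
    simp only [add_tsub_cancel_of_le hν] at hqg
    have hqg' := lowerSpan_mono _ (show _ ≤ j by simp only [vecOrder] at hk ⊢; linarith) hqg
    have hqS : q • g i (ν₀, k₀) ∈ S := by
      refine Submodule.subset_span ⟨_, Set.mem_iUnion.2 ⟨i, _, hmin, rfl⟩, q,
        Vfil_mono d ?_ hq, rfl⟩
      simp only [vecOrder] at hk ⊢
      linarith
    rw [← sub_add_cancel v (z • q • g i (ν₀, k₀))]
    refine add_mem (hlow _ ?_ ?_) (S.smul_mem z hqS)
    · refine sub_mem hvI ?_
      rw [← algebraMap_smul (Weyl n)]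
      exact I.smul_mem _ (I.smul_mem _ hgI)
    · have h := sub_mem hz (Submodule.smul_mem _ z hqg')
      rwa [smul_sub, sub_sub_sub_cancel_right] at h
  rcases eq_zero_or_exists_mem_span_le _ (vecKey mo) _
    (mem_span_vecMonomial_of_mem_VfilFree hv) with rfl | ⟨M, hM, hvM⟩
  · exact zero_mem _
  · exact key _ M rfl hM v hvI hvM

end StandardBasis

theorem VfilFree_smul_mem {n d m : ℕ} {𝔪 : Fin m → ℤ} {r j : ℤ} {q : Weyl n}
    {u : Fin m → Weyl n} (hq : q ∈ Vfil n d (j - r)) (hu : u ∈ VfilFree n d 𝔪 r) :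
    q • u ∈ VfilFree n d 𝔪 j := fun i => by
  have h := mul_mem_Vfil hq (hu i)
  rwa [sub_add_sub_cancel] at h

theorem exists_shift_mem_VfilFree {n m : ℕ} (d : ℕ) {κ : Type*} {s : Set κ} (hs : s.Finite)
    (u : κ → Fin m → Weyl n) (r : κ → ℤ) :
    ∃ 𝔪 : Fin m → ℤ, ∀ p ∈ s, u p ∈ VfilFree n d 𝔪 (r p) := by
  choose o ho using fun (p : κ) (i : Fin m) => exists_mem_Vfil d (u p i)
  have hbdd (i : Fin m) : ∃ k, ∀ p ∈ s, k ≤ r p - o p i := by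
    obtain ⟨k, hk⟩ := (hs.image fun p => r p - o p i).bddBelow
    exact ⟨k, fun p hp => hk ⟨p, hp, rfl⟩⟩
  choose 𝔪 h𝔪 using hbdd
  exact ⟨𝔪, fun p hp i => Vfil_mono d (by linarith [h𝔪 i p hp]) (ho p i)⟩

/-- Lifting finitely many generators through `ψ` gives a shift vector for which the lift respects
the filtration generated by them. -/
theorem exists_shift_of_lift {n d m c : ℕ} {B : Type*} [AddCommGroup B] [Module (Weyl n) B]
    {s : Set ((Fin c → Weyl n) × ℤ)} (hs : s.Finite) (φ : (Fin c → Weyl n) →ₗ[Weyl n] B)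
    (ψ : (Fin m → Weyl n) →ₗ[Weyl n] B) (hlift : ∀ p ∈ s, ∃ u, φ p.1 = ψ u) :
    ∃ 𝔪 : Fin m → ℤ, ∀ j,
      ∀ v ∈ Submodule.span ℂ {w | ∃ p ∈ s, ∃ q ∈ Vfil n d (j - p.2), w = q • p.1},
        ∃ u ∈ VfilFree n d 𝔪 j, φ v = ψ u := by
  have hlift' (p : (Fin c → Weyl n) × ℤ) : ∃ u, p ∈ s → φ p.1 = ψ u := by
    by_cases hp : p ∈ s
    · obtain ⟨u, hu⟩ := hlift p hp
      exact ⟨u, fun _ => hu⟩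
    · exact ⟨0, fun h => absurd h hp⟩
  choose u hu using hlift'
  obtain ⟨𝔪, h𝔪⟩ := exists_shift_mem_VfilFree d hs u Prod.snd
  refine ⟨𝔪, fun j v hv => ?_⟩
  induction hv using Submodule.span_induction with
  | mem v hv =>
    obtain ⟨p, hp, q, hq, rfl⟩ := hv
    exact ⟨q • u p, VfilFree_smul_mem hq (h𝔪 p hp), by rw [map_smul, map_smul, hu p hp]⟩
  | zero => exact ⟨0, fun i => zero_mem _, by rw [map_zero, map_zero]⟩
  | add x y _ _ hx hy =>
    obtain ⟨x', hx', hx⟩ := hx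
    obtain ⟨y', hy', hy⟩ := hy
    exact ⟨x' + y', fun i => add_mem (hx' i) (hy' i), by rw [map_add, map_add, hx, hy]⟩
  | smul z x _ hx =>
    obtain ⟨x', hx', hx⟩ := hx
    refine ⟨z • x', fun i => Submodule.smul_mem _ z (hx' i), ?_⟩
    rw [← algebraMap_smul (Weyl n) z x, ← algebraMap_smul (Weyl n) z x', map_smul, map_smul, hx]

/-- **Statement 6.** (Lemma on making a short exact sequence `V_d`-strict.)
Given a short exact sequence `0 → A → B → C → 0` of left `Dₙ`-modules
presented as quotients of finitely generated free modules `P_A, P_B, P_C`,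
and a shift vector `𝔪_C` on `P_C`, the module `B` can be re-presented as a
quotient of `Q_B = P_A ⊕ P_C` compatibly with the maps (the composite
`Q_B → B → C` being the projection to `P_C` followed by `P_C → C`), and there
is a shift vector `𝔪_A` on `P_A` such that, with `𝔪_B = (𝔪_A, 𝔪_C)` and the
induced quotient filtrations, the sequence
`0 → F^j(A) → F^j(B) → F^j(C) → 0` is exact for every `j`, i.e. the sequence
is `V_d`-strict. -/
theorem strictify_short_exact_sequence
    (n d : ℕ) (hd : d ≤ n) (a b c : ℕ)
    (A B C : Type) [AddCommGroup A] [Module (Weyl n) A]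
    [AddCommGroup B] [Module (Weyl n) B] [AddCommGroup C] [Module (Weyl n) C]
    (ι : A →ₗ[Weyl n] B) (π : B →ₗ[Weyl n] C)
    (hinj : Function.Injective ι) (hsurj : Function.Surjective π)
    (hexact : ∀ y : B, π y = 0 ↔ ∃ x : A, ι x = y)
    (pA : (Fin a → Weyl n) →ₗ[Weyl n] A) (hpA : Function.Surjective pA)
    (pB : (Fin b → Weyl n) →ₗ[Weyl n] B) (hpB : Function.Surjective pB)
    (pC : (Fin c → Weyl n) →ₗ[Weyl n] C) (hpC : Function.Surjective pC)
    (𝔪C : Fin c → ℤ) :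
    ∃ (pQ : ((Fin a → Weyl n) × (Fin c → Weyl n)) →ₗ[Weyl n] B)
      (𝔪A : Fin a → ℤ),
      Function.Surjective pQ ∧
      (∀ u : Fin a → Weyl n, pQ (u, 0) = ι (pA u)) ∧
      (∀ u v, π (pQ (u, v)) = pC v) ∧
      (∀ j : ℤ,
        -- `F^j(A) := pA(F^j[𝔪A] P_A)`, `F^j(B) := pQ(F^j[(𝔪A,𝔪C)] Q_B)`,
        -- `F^j(C) := pC(F^j[𝔪C] P_C)`; the sequence of filtration levels is exact:
        (∀ x ∈ pA '' VfilFree n d 𝔪A j,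
          ι x ∈ pQ '' {w | w.1 ∈ VfilFree n d 𝔪A j ∧ w.2 ∈ VfilFree n d 𝔪C j}) ∧
        (∀ y ∈ pQ '' {w | w.1 ∈ VfilFree n d 𝔪A j ∧ w.2 ∈ VfilFree n d 𝔪C j},
          π y ∈ pC '' VfilFree n d 𝔪C j) ∧
        (∀ y ∈ pQ '' {w | w.1 ∈ VfilFree n d 𝔪A j ∧ w.2 ∈ VfilFree n d 𝔪C j},
          π y = 0 → ∃ x ∈ pA '' VfilFree n d 𝔪A j, ι x = y) ∧
        (∀ z ∈ pC '' VfilFree n d 𝔪C j,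
          ∃ y ∈ pQ '' {w | w.1 ∈ VfilFree n d 𝔪A j ∧ w.2 ∈ VfilFree n d 𝔪C j},
            π y = z)) := by
  obtain ⟨s, hs, hsI, hspan⟩ := exists_finite_standard_basis d 𝔪C (LinearMap.ker pC)
  choose bC hbC using fun k : Fin c => hsurj (pC (Pi.single k 1))
  let φ : (Fin c → Weyl n) →ₗ[Weyl n] B := Fintype.linearCombination (Weyl n) bC
  have hφ (v) : π (φ v) = pC v := by
    simp only [φ, Fintype.linearCombination_apply, map_sum, map_smul, hbC]
    simp only [← map_smul, ← map_sum, ← Pi.single_smul, smul_eq_mul, mul_one,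
      Finset.univ_sum_single]
  have hlift (v) (hv : pC v = 0) : ∃ u, φ v = ι (pA u) := by
    obtain ⟨x, hx⟩ := (hexact (φ v)).1 ((hφ v).trans hv)
    obtain ⟨u, rfl⟩ := hpA x
    exact ⟨u, hx.symm⟩
  obtain ⟨𝔪A, h𝔪A⟩ := exists_shift_of_lift hs φ (ι ∘ₗ pA) fun p hp => hlift _ (hsI p hp)
  have hker (j v) (hv : v ∈ VfilFree n d 𝔪C j) (h0 : pC v = 0) :
      ∃ u ∈ VfilFree n d 𝔪A j, φ v = ι (pA u) := h𝔪A j v (hspan j v hv h0)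
  have hpQ (u v) : (ι ∘ₗ pA).coprod φ (u, v) = ι (pA u) + φ v := rfl
  have hπι (x) : π (ι x) = 0 := (hexact _).2 ⟨x, rfl⟩
  have hπ (u v) : π ((ι ∘ₗ pA).coprod φ (u, v)) = pC v := by
    rw [hpQ, map_add, hπι, zero_add, hφ]
  refine ⟨(ι ∘ₗ pA).coprod φ, 𝔪A, fun y => ?_, fun u => ?_, hπ, fun j => ⟨?_, ?_, ?_, ?_⟩⟩
  · obtain ⟨v, hv⟩ := hpC (π y)
    obtain ⟨x, hx⟩ := (hexact (y - φ v)).1 (by rw [map_sub, hφ, hv, sub_self])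
    obtain ⟨u, rfl⟩ := hpA x
    exact ⟨(u, v), by rw [hpQ, hx, sub_add_cancel]⟩
  · rw [hpQ, map_zero, add_zero]
  · rintro _ ⟨u, hu, rfl⟩
    exact ⟨(u, 0), ⟨hu, fun i => zero_mem _⟩, by rw [hpQ, map_zero, add_zero]⟩
  · rintro _ ⟨⟨u, v⟩, ⟨_, hv⟩, rfl⟩
    exact ⟨v, hv, (hπ u v).symm⟩
  · rintro _ ⟨⟨u, v⟩, ⟨hu, hv⟩, rfl⟩ h0
    obtain ⟨u', hu', h⟩ := hker j v hv ((hπ u v).symm.trans h0)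
    exact ⟨_, ⟨u + u', fun i => add_mem (hu i) (hu' i), rfl⟩, by rw [hpQ, h, map_add, map_add]⟩
  · rintro _ ⟨v, hv, rfl⟩
    exact ⟨_, ⟨(0, v), ⟨fun i => zero_mem _, hv⟩, rfl⟩, hπ 0 v⟩
end
end
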